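/- arXiv:2108.13659 — 9 statements merged into one kernel-verified Lean document; each statement's English description precedes it below -/
import Mathlib

section
/- Let p ≥ 3, k ≥ 2 and n ≥ k. If there exists a σ_{k-1}-Gray cycle over the set of all words of length n-1 over the p-letter alphabet, then there exists a σ_k-Gray cycle over the set of all words of length n over the p-letter alphabet. -/
/-- A sigma_k-Gray cycle over the set of *all* words of length `n` over a `p`-letter
alphabet: a cyclic enumeration `w` of all `p ^ n` words, each exactly once, with
consecutive words (cyclically) at Hamming distance exactly `k`. -/
def GrayCycleAll (p n k : ℕ) (w : ZMod (p ^ n) → (Fin n → Fin p)) : Prop :=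
  Function.Bijective w ∧ ∀ i, hammingDist (w i) (w (i + 1)) = k

theorem hammingDist_cons_aux {m p : ℕ} (a b : Fin p) (x y : Fin m → Fin p) (hab : a ≠ b) :
    hammingDist (Fin.cons a x : Fin (m + 1) → Fin p) (Fin.cons b y) = hammingDist x y + 1 := by
  unfold hammingDist
  rw [Finset.card_filter, Finset.card_filter, Fin.sum_univ_succ]
  simp [hab, add_comm]

/-- Induction step: for `p ≥ 3`, `k ≥ 2`, `n ≥ k`, a sigma_{k-1}-Gray cycle over all
words of length `n - 1` yields a sigma_k-Gray cycle over all words of length `n`. -/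
theorem stmt1 (p n k : ℕ) (hp : 3 ≤ p) (hk : 2 ≤ k) (hn : k ≤ n)
    (h : ∃ w : ZMod (p ^ (n - 1)) → (Fin (n - 1) → Fin p),
      GrayCycleAll p (n - 1) (k - 1) w) :
    ∃ w : ZMod (p ^ n) → (Fin n → Fin p), GrayCycleAll p n k w := by
  obtain ⟨m, rfl⟩ : ∃ m, n = m + 1 := ⟨n - 1, by omega⟩
  obtain ⟨l, rfl⟩ : ∃ l, k = l + 1 := ⟨k - 1, by omega⟩
  simp only [Nat.add_sub_cancel] at h
  obtain ⟨u, hu, hd⟩ := h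
  have hm : m ≠ 0 := by omega
  have hp0 : 0 < p := by omega
  have hMp : p ∣ p ^ m := dvd_pow_self p hm
  have hM0 : 0 < p ^ m := by positivity
  have hN : p ^ (m + 1) = p * p ^ m := by rw [pow_succ, mul_comm]
  have hN0 : 0 < p ^ (m + 1) := by positivity
  haveI : NeZero (p ^ m) := ⟨hM0.ne'⟩
  haveI : NeZero (p ^ (m + 1)) := ⟨hN0.ne'⟩
  let c : ℕ → Fin p := fun j => ⟨(j + j / p ^ m) % p, Nat.mod_lt _ hp0⟩
  let g : ℕ → (Fin (m + 1) → Fin p) := fun j => Fin.cons (c j) (u (j : ZMod (p ^ m)))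
  have hper : Function.Periodic g (p ^ (m + 1)) := by
    intro j
    have h1 : c (j + p ^ (m + 1)) = c j := by
      apply Fin.ext
      change (j + p ^ (m + 1) + (j + p ^ (m + 1)) / p ^ m) % p = (j + j / p ^ m) % p
      rw [hN, Nat.add_mul_div_right _ _ hM0]
      have : j + p * p ^ m + (j / p ^ m + p) = (j + j / p ^ m) + p * (p ^ m + 1) := by ring
      rw [this, Nat.add_mul_mod_self_left]
    have h2 : ((j + p ^ (m + 1) : ℕ) : ZMod (p ^ m)) = (j : ZMod (p ^ m)) := by
      rw [ZMod.natCast_eq_natCast_iff', hN, Nat.add_mul_mod_self_right]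
    change (Fin.cons (c (j + p ^ (m + 1))) (u ((j + p ^ (m + 1) : ℕ) : ZMod (p ^ m))) :
      Fin (m + 1) → Fin p) = Fin.cons (c j) (u (j : ZMod (p ^ m)))
    rw [h1, h2]
  have hc : ∀ j, c j ≠ c (j + 1) := by
    intro j hj
    have hj' : (j + j / p ^ m) % p = (j + 1 + (j + 1) / p ^ m) % p := congrArg Fin.val hj
    have hmod : (j + j / p ^ m) ≡ (j + 1 + (j + 1) / p ^ m) [MOD p] := hj'
    rw [Nat.succ_div] at hmod
    have hdvd := (Nat.modEq_iff_dvd' (by split_ifs <;> omega)).1 hmod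
    split_ifs at hdvd
    · have := Nat.le_of_dvd (by omega) hdvd
      omega
    · have := Nat.le_of_dvd (by omega) hdvd
      omega
  refine ⟨fun i => g i.val, ?_, ?_⟩
  · rw [Fintype.bijective_iff_injective_and_card]
    refine ⟨?_, by simp [ZMod.card]⟩
    intro a b hab
    have hab' : (Fin.cons (c a.val) (u (a.val : ZMod (p ^ m))) : Fin (m + 1) → Fin p)
      = Fin.cons (c b.val) (u (b.val : ZMod (p ^ m))) := hab
    obtain ⟨h1, h2⟩ := Fin.cons_injective2 hab'
    have h3 := hu.1 h2
    rw [ZMod.natCast_eq_natCast_iff'] at h3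
    have h4 : (a.val + a.val / p ^ m) % p = (b.val + b.val / p ^ m) % p := congrArg Fin.val h1
    have h5 : a.val ≡ b.val [MOD p] := Nat.ModEq.of_dvd hMp h3
    have h6 : a.val / p ^ m ≡ b.val / p ^ m [MOD p] := Nat.ModEq.add_left_cancel h5 h4
    have ha : a.val / p ^ m < p := Nat.div_lt_of_lt_mul (by
      have := ZMod.val_lt a
      rw [mul_comm]; omega)
    have hb : b.val / p ^ m < p := Nat.div_lt_of_lt_mul (by
      have := ZMod.val_lt b
      rw [mul_comm]; omega)
    have h7 := h6.eq_of_lt_of_lt ha hb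
    apply ZMod.val_injective
    rw [← Nat.div_add_mod a.val (p ^ m), ← Nat.div_add_mod b.val (p ^ m), h3, h7]
  · intro i
    have hs : g (i + 1).val = g (i.val + 1) := by
      have : (i + 1).val = (i.val + 1) % p ^ (m + 1) := by
        rw [ZMod.val_add, ZMod.val_one_eq_one_mod, Nat.add_mod_mod]
      rw [this, hper.map_mod_nat]
    change hammingDist (g i.val) (g (i + 1).val) = l + 1
    rw [hs]
    change hammingDist (Fin.cons (c i.val) (u (i.val : ZMod (p ^ m))) : Fin (m + 1) → Fin p)
      (Fin.cons (c (i.val + 1)) (u ((i.val + 1 : ℕ) : ZMod (p ^ m)))) = l + 1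
    rw [hammingDist_cons_aux _ _ _ _ (hc _), Nat.cast_add, Nat.cast_one, hd]
end

section
/- For every alphabet size p ≥ 3 and all integers n ≥ k ≥ 1, there exists a σ_k-Gray cycle over the set of all p^n words of length n over the p-letter alphabet. -/
/-- Modular Gray code. -/
def modGray (p n m : ℕ) : Fin n → ZMod p := fun j =>
  ((m / p ^ (j : ℕ) : ℕ) : ZMod p) -
    (if (j : ℕ) + 1 < n then ((m / p ^ ((j : ℕ) + 1) : ℕ) : ZMod p) else 0)

/-- Basis of vectors of weight `k`. -/
def wtVec (p n k : ℕ) (j i : Fin n) : ZMod p :=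
  if (j : ℕ) < k then
    (if (i : ℕ) < k then (if i = j ∧ (j : ℕ) ≠ 0 then 2 else 1) else 0)
  else (if (i : ℕ) + 1 < k ∨ i = j then 1 else 0)

theorem digit_mod (p n m j : ℕ) (hp : 0 < p) (hj : j < n) :
    (((m % p ^ n) / p ^ j : ℕ) : ZMod p) = ((m / p ^ j : ℕ) : ZMod p) := by
  obtain ⟨d, rfl⟩ : ∃ d, n = j + (d + 1) := ⟨n - j - 1, by omega⟩
  conv_rhs => rw [← Nat.mod_add_div m (p ^ (j + (d + 1)))]
  rw [pow_add p j (d+1), mul_assoc, Nat.add_mul_div_left _ _ (by positivity)]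
  push_cast
  simp [pow_succ]

theorem modGray_mod (p n m : ℕ) (hp : 0 < p) : modGray p n (m % p ^ n) = modGray p n m := by
  funext j
  unfold modGray
  rw [digit_mod p n m j hp j.2]
  split_ifs with h
  · rw [digit_mod p n m _ hp h]
  · rfl

theorem modGray_step (p n m : ℕ) (hn : 0 < n) :
    ∃ j : Fin n, modGray p n (m + 1) = modGray p n m + Pi.single j 1 := by
  classical
  let P : ℕ → Prop := fun j => p ^ j ∣ m + 1
  have h0 : P 0 := by simp [P]
  let v := Nat.findGreatest P (n - 1)
  have hv : P v := Nat.findGreatest_spec (Nat.zero_le _) h0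
  have hvle : v ≤ n - 1 := Nat.findGreatest_le _
  have key : ∀ j, j < n → (p ^ j ∣ m + 1 ↔ j ≤ v) := by
    intro j hj
    constructor
    · intro h
      exact Nat.le_findGreatest (by omega) h
    · intro h
      exact (pow_dvd_pow p h).trans hv
  refine ⟨⟨v, by omega⟩, ?_⟩
  funext j
  have hj := j.2
  simp only [modGray, Nat.succ_div, Pi.add_apply, Pi.single_apply, Fin.ext_iff]
  simp only [key j hj]
  by_cases h : (j : ℕ) + 1 < n
  · rw [if_pos h, if_pos h]
    simp only [key _ h]
    rcases lt_trichotomy (j : ℕ) v with h1 | h1 | h1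
    · rw [if_pos (by omega), if_pos (by omega), if_neg (by omega)]; push_cast; ring
    · rw [if_pos (by omega), if_neg (by omega), if_pos (by omega)]; push_cast; ring
    · rw [if_neg (by omega), if_neg (by omega), if_neg (by omega)]; push_cast; ring
  · rw [if_neg h, if_neg h]
    by_cases h1 : (j : ℕ) = v
    · rw [if_pos (by omega), if_pos h1]; push_cast; ring
    · rw [if_neg (by omega), if_neg h1]; push_cast; ring

theorem modGray_inj (p n a b : ℕ) (ha : a < p ^ n) (hb : b < p ^ n)
    (h : modGray p n a = modGray p n b) : a = b := by
  have h1 : ∀ d j, j + d + 1 = n → ((a / p ^ j : ℕ) : ZMod p) = ((b / p ^ j : ℕ) : ZMod p) := by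
    intro d
    induction d with
    | zero =>
      intro j hj
      have := congrFun h ⟨j, by omega⟩
      simpa [modGray, show ¬ (j + 1 < n) by omega] using this
    | succ d ih =>
      intro j hj
      have := congrFun h ⟨j, by omega⟩
      simp only [modGray, show (j + 1 < n) by omega, if_true] at this
      rw [ih (j+1) (by omega)] at this
      exact sub_left_injective this
  have h2 : ∀ j, j ≤ n → a % p ^ j = b % p ^ j := by
    intro j
    induction j with
    | zero => intro _; simp [Nat.mod_one]
    | succ j ih =>
      intro hj
      have e := h1 (n - j - 1) j (by omega)
      rw [ZMod.natCast_eq_natCast_iff'] at e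
      rw [Nat.mod_pow_succ, Nat.mod_pow_succ, e, ih (by omega)]
  have := h2 n le_rfl
  rwa [Nat.mod_eq_of_lt ha, Nat.mod_eq_of_lt hb] at this

theorem wtVec_norm (p n k : ℕ) (hp : 3 ≤ p) (hk : 1 ≤ k) (hn : k ≤ n) (j : Fin n) :
    hammingNorm (wtVec p n k j) = k := by
  classical
  have : Fact (1 < p) := ⟨by omega⟩
  have h2 : (2 : ZMod p) ≠ 0 := by
    intro h
    have : ((2 : ℕ) : ZMod p) = 0 := by exact_mod_cast h
    rw [ZMod.natCast_eq_zero_iff] at this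
    have := Nat.le_of_dvd (by norm_num) this
    omega
  have h1 : (1 : ZMod p) ≠ 0 := one_ne_zero
  unfold hammingNorm
  have cardlt : ∀ l, l ≤ n → (Finset.univ.filter (fun i : Fin n => (i : ℕ) < l)).card = l := by
    intro l hl
    rw [Fin.card_filter_val_lt]; omega
  by_cases hj : (j : ℕ) < k
  · have : (Finset.univ.filter (fun i : Fin n => wtVec p n k j i ≠ 0)) =
        Finset.univ.filter (fun i : Fin n => (i : ℕ) < k) := by
      ext i
      simp only [wtVec, hj, if_true, Finset.mem_filter, Finset.mem_univ, true_and]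
      split_ifs <;> simp_all
    rw [this, cardlt k hn]
  · have : (Finset.univ.filter (fun i : Fin n => wtVec p n k j i ≠ 0)) =
        insert j (Finset.univ.filter (fun i : Fin n => (i : ℕ) < k - 1)) := by
      ext i
      simp only [wtVec, hj, if_false, Finset.mem_filter, Finset.mem_univ, true_and,
        Finset.mem_insert]
      have e : (i : ℕ) < k - 1 ↔ (i : ℕ) + 1 < k := by omega
      rw [e]
      split_ifs with h
      · simp only [ne_eq, h1, not_false_eq_true, true_iff]; tauto
      · simp only [ne_eq, not_true_eq_false, false_iff]; tauto
    rw [this, Finset.card_insert_of_notMem, cardlt _ (by omega)]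
    · omega
    · simp; omega

theorem wtVec_indep (p n k : ℕ) (hk : 1 ≤ k) (hn : k ≤ n) (x : Fin n → ZMod p)
    (hx : ∑ j, x j • wtVec p n k j = 0) : x = 0 := by
  classical
  have hc : ∀ i, ∑ j, x j * wtVec p n k j i = 0 := by
    intro i
    simpa using congrFun hx i
  have big : ∀ i : Fin n, k ≤ (i : ℕ) → x i = 0 := by
    intro i hi
    rw [← hc i, Finset.sum_eq_single i]
    · simp [wtVec, show ¬ ((i : ℕ) < k) by omega]
    · intro j _ hj
      simp only [wtVec, show ¬ ((i : ℕ) < k) by omega, show ¬ ((i : ℕ) + 1 < k) by omega, hj.symm]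
      simp
    · simp
  have T : ∑ j, x j = 0 := by
    rw [← hc ⟨0, by omega⟩]
    refine Finset.sum_congr rfl fun j _ => ?_
    by_cases hj : (j : ℕ) < k
    · have : wtVec p n k j ⟨0, by omega⟩ = 1 := by
        unfold wtVec
        rw [if_pos hj, if_pos (by show 0 < k; omega), if_neg]
        rintro ⟨h, h'⟩
        apply h'
        rw [← h]
      rw [this, mul_one]
    · rw [big j (by omega), zero_mul]
  have mid : ∀ i : Fin n, (i : ℕ) ≠ 0 → x i = 0 := by
    intro i hi
    by_cases hik : k ≤ (i : ℕ)
    · exact big i hik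
    have e : ∑ j, x j * wtVec p n k j i = ∑ j, (x j + if j = i then x j else 0) := by
      refine Finset.sum_congr rfl fun j _ => ?_
      by_cases hj : (j : ℕ) < k
      · by_cases hji : j = i
        · subst hji
          simp [wtVec, hj, hi]; ring
        · simp [wtVec, hj, hji, show (i : ℕ) < k by omega, Ne.symm hji]
      · rw [big j (by omega)]; simp
    rw [hc i, Finset.sum_add_distrib, T] at e
    simpa using e.symm
  funext i
  by_cases hi : (i : ℕ) = 0
  · rw [Finset.sum_eq_single i] at T
    · exact T
    · intro j _ hj
      exact mid j fun h => hj (Fin.ext (by omega))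
    · simp
  · exact mid i hi

theorem gray_zmod (p n k : ℕ) (hp : 3 ≤ p) (hk : 1 ≤ k) (hn : k ≤ n) :
    ∃ w : ZMod (p ^ n) → (Fin n → ZMod p), Function.Injective w ∧
      ∀ i, hammingDist (w i) (w (i + 1)) = k := by
  classical
  have : NeZero (p ^ n) := ⟨by positivity⟩
  have hpn : 1 < p ^ n := Nat.one_lt_pow (by omega) (by omega)
  have : Fact (1 < p ^ n) := ⟨hpn⟩
  refine ⟨fun i => ∑ j, modGray p n i.val j • wtVec p n k j, ?_, ?_⟩
  · intro a b hab
    have : modGray p n a.val - modGray p n b.val = 0 := by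
      apply wtVec_indep p n k hk hn
      simp only [Pi.sub_apply, sub_smul, Finset.sum_sub_distrib]
      exact sub_eq_zero.2 hab
    exact ZMod.val_injective _
      (modGray_inj p n _ _ (ZMod.val_lt a) (ZMod.val_lt b) (sub_eq_zero.1 this))
  · intro i
    obtain ⟨j, hj⟩ := modGray_step p n i.val (by omega)
    have e : modGray p n (i + 1).val = modGray p n i.val + Pi.single j 1 := by
      rw [ZMod.val_add, ZMod.val_one, modGray_mod _ _ _ (by omega), hj]
    have e2 : ∑ l, modGray p n (i + 1).val l • wtVec p n k l =
        ∑ l, modGray p n i.val l • wtVec p n k l + wtVec p n k j := by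
      rw [e]
      simp only [Pi.add_apply, add_smul, Finset.sum_add_distrib]
      congr 1
      rw [Finset.sum_eq_single j]
      · simp
      · intro l _ hl
        simp [hl]
      · simp
    show hammingDist (∑ l, modGray p n i.val l • wtVec p n k l)
      (∑ l, modGray p n (i + 1).val l • wtVec p n k l) = k
    rw [e2]
    refine Eq.trans ?_ (wtVec_norm p n k hp hk hn j)
    simp [hammingDist, hammingNorm]

/-- For every `p ≥ 3` and `n ≥ k ≥ 1` there exists a sigma_k-Gray cycle over the set
of all `p ^ n` words of length `n` over the `p`-letter alphabet. -/
theorem stmt2 (p n k : ℕ) (hp : 3 ≤ p) (hk : 1 ≤ k) (hn : k ≤ n) :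
    ∃ w : ZMod (p ^ n) → (Fin n → Fin p), GrayCycleAll p n k w := by
  classical
  have : NeZero (p ^ n) := ⟨by positivity⟩
  have : NeZero p := ⟨by omega⟩
  obtain ⟨w, hw, hd⟩ := gray_zmod p n k hp hk hn
  let f : ZMod p ≃ Fin p := Fintype.equivFinOfCardEq (ZMod.card p)
  refine ⟨fun i l => f (w i l), ?_, ?_⟩
  · rw [Fintype.bijective_iff_injective_and_card]
    refine ⟨fun a b hab => hw (funext fun l => f.injective (congrFun hab l)), ?_⟩
    rw [ZMod.card]; simp
  · intro i
    rw [← hd i]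
    exact hammingDist_comp (fun _ => f) (fun _ => f.injective)
end

section
/- Let p ≥ 3 and n ≥ k ≥ 1. The maximum cardinality of a finite set X of words of length at most n over a p-letter alphabet such that some σ_k-Gray cycle over X exists, equals p^n; that is, λ_{A,σ_k}(n) = p^n when |A| = p ≥ 3. -/
/-- The k-character substitution: `u` and `v` have the same length and differ in
exactly `k` positions. -/
def sigmaRel {A : Type*} [DecidableEq A] (k : ℕ) (u v : List A) : Prop :=
  u.length = v.length ∧ ((u.zip v).filter fun q => decide (q.1 ≠ q.2)).length = k

/-- A sigma_k-Gray cycle over a finite set `X` of words (lists): a sequence of `X.card`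
words enumerating each element of `X` exactly once such that consecutive words
(cyclically, including the wrap-around pair) are related by `sigmaRel k`. -/
def GrayCycleList {A : Type*} [DecidableEq A] (k : ℕ) (X : Finset (List A))
    (w : ZMod X.card → List A) : Prop :=
  Function.Injective w ∧ (∀ x, x ∈ X ↔ ∃ i, w i = x) ∧
  ∀ i, sigmaRel k (w i) (w (i + 1))


/-- Modular Gray code: the `j`-th digit at time `t`. -/
def gx (p n t : ℕ) (j : Fin n) : ZMod p :=
  if (j : ℕ) + 1 < n then ((t / p ^ (j : ℕ) : ℕ) : ZMod p) - ((t / p ^ ((j : ℕ) + 1) : ℕ) : ZMod p)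
  else ((t / p ^ (j : ℕ) : ℕ) : ZMod p)

lemma gx_step (p n t : ℕ) (hn : 1 ≤ n) (_hp : 3 ≤ p) :
    ∃ v : Fin n, gx p n (t + 1) = gx p n t + Pi.single v 1 := by
  classical
  have h0 : (p ^ 0 ∣ t + 1) := by simp
  let P : ℕ → Prop := fun j => p ^ j ∣ t + 1
  obtain ⟨v, hv, hPv, hmax⟩ : ∃ v, v ≤ n - 1 ∧ P v ∧ ∀ j, j ≤ n - 1 → P j → j ≤ v := by
    refine ⟨Nat.findGreatest P (n - 1), Nat.findGreatest_le _, ?_, ?_⟩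
    · exact Nat.findGreatest_spec (P := P) (Nat.zero_le _) h0
    · intro j hj hPj
      exact Nat.le_findGreatest hj hPj
  have hiff : ∀ j, j ≤ n - 1 → (p ^ j ∣ t + 1 ↔ j ≤ v) := by
    intro j hj
    exact ⟨hmax j hj, fun h => (pow_dvd_pow p h).trans hPv⟩
  refine ⟨⟨v, by omega⟩, ?_⟩
  funext j
  have hj := j.2
  simp only [gx, Pi.add_apply, Pi.single_apply, Fin.ext_iff, Nat.succ_div]
  rw [if_congr (hiff j (by omega)) rfl rfl]
  by_cases hj1 : (j : ℕ) + 1 < n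
  · rw [if_congr (hiff (j + 1) (by omega)) rfl rfl]
    simp only [hj1, if_true]
    by_cases h1 : (j : ℕ) + 1 ≤ v
    · simp [h1, show (j : ℕ) ≤ v by omega, show (j : ℕ) ≠ v by omega]
    · by_cases h2 : (j : ℕ) = v
      · simp [h2]; ring
      · simp [h1, h2, show ¬ (j : ℕ) ≤ v by omega]
  · simp only [hj1, if_false]
    by_cases h2 : (j : ℕ) = v
    · simp [h2]
    · simp [h2, show ¬ (j : ℕ) ≤ v by omega]

lemma gx_wrap (p n : ℕ) (hp : 3 ≤ p) : gx p n (p ^ n) = gx p n 0 := by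
  have key : ∀ j, j < n → ((p ^ n / p ^ j : ℕ) : ZMod p) = 0 := by
    intro j hj
    rw [Nat.pow_div hj.le (by omega)]
    obtain ⟨m, hm⟩ : ∃ m, n - j = m + 1 := ⟨n - j - 1, by omega⟩
    rw [hm, pow_succ]; simp
  funext j
  unfold gx
  by_cases h : (j : ℕ) + 1 < n
  · simp [h, key _ h, key _ j.2]
  · simp [h, key _ j.2]

lemma gx_inj (p n s t : ℕ) (hs : s < p ^ n) (ht : t < p ^ n)
    (h : gx p n s = gx p n t) : s = t := by
  have hD : ∀ d j, j < n → n - j = d → ((s / p ^ j : ℕ) : ZMod p) = ((t / p ^ j : ℕ) : ZMod p) := by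
    intro d
    induction d with
    | zero => intro j hj hd; omega
    | succ d ih =>
      intro j hj hd
      have h1 := congrFun h ⟨j, hj⟩
      simp only [gx] at h1
      by_cases hj1 : j + 1 < n
      · simp only [hj1, if_true] at h1
        have := ih (j + 1) hj1 (by omega)
        rw [this] at h1
        exact sub_left_injective h1
      · simpa only [hj1, if_false] using h1
  have hm : ∀ j, j ≤ n → s % p ^ j = t % p ^ j := by
    intro j
    induction j with
    | zero => intro _; simp [Nat.mod_one]
    | succ j ih =>
      intro hj
      have h1 := (ZMod.natCast_eq_natCast_iff' _ _ _).1 (hD _ j hj rfl)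
      rw [Nat.mod_pow_succ, Nat.mod_pow_succ, ih (by omega), h1]
  have := hm n le_rfl
  rwa [Nat.mod_eq_of_lt hs, Nat.mod_eq_of_lt ht] at this

/-- Linear automorphism sending unit vectors to vectors of weight `k`. -/
def gM (p n k : ℕ) (x : Fin n → ZMod p) (c : Fin n) : ZMod p :=
  if (c : ℕ) = 0 then ∑ j with (j : Fin n).val < k, x j
  else if (c : ℕ) < k then (∑ j, x j) + x c else x c

lemma gM_inj (p n k : ℕ) (hk : 1 ≤ k) (hn : k ≤ n) : Function.Injective (gM p n k) := by
  intro x y h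
  have h1 : ∀ c : Fin n, ¬ (c : ℕ) < k → x c = y c := by
    intro c hc
    have := congrFun h c
    simpa [gM, hc, show (c : ℕ) ≠ 0 by omega] using this
  have h2 : ∑ j with (j : Fin n).val < k, x j = ∑ j with (j : Fin n).val < k, y j := by
    have := congrFun h ⟨0, by omega⟩
    simpa [gM] using this
  have h3 : ∑ j, x j = ∑ j, y j := by
    rw [← Finset.sum_filter_add_sum_filter_not Finset.univ (fun j : Fin n => j.val < k) x,
      ← Finset.sum_filter_add_sum_filter_not Finset.univ (fun j : Fin n => j.val < k) y, h2]
    congr 1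
    apply Finset.sum_congr rfl
    intro j hj
    exact h1 j (by simpa using hj)
  have h4 : ∀ c : Fin n, (c : ℕ) ≠ 0 → x c = y c := by
    intro c hc
    by_cases hck : (c : ℕ) < k
    · have := congrFun h c
      simp only [gM, hc, hck, if_true, if_false, h3] at this
      exact add_left_cancel this
    · exact h1 c hck
  funext c
  by_cases hc : (c : ℕ) = 0
  · rw [← Finset.add_sum_erase _ x (Finset.mem_univ c),
      ← Finset.add_sum_erase _ y (Finset.mem_univ c)] at h3
    have : ∑ j ∈ Finset.univ.erase c, x j = ∑ j ∈ Finset.univ.erase c, y j := by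
      apply Finset.sum_congr rfl
      intro j hj
      apply h4
      intro hj0
      apply (Finset.mem_erase.1 hj).1
      ext; omega
    rw [this] at h3
    exact add_right_cancel h3
  · exact h4 c hc

lemma gM_step (p n k : ℕ) (hp : 3 ≤ p) (hk : 1 ≤ k) (hn : k ≤ n) (x : Fin n → ZMod p)
    (v : Fin n) :
    (Finset.univ.filter fun c => gM p n k x c ≠ gM p n k (x + Pi.single v 1) c).card = k := by
  classical
  haveI : Fact (1 < p) := ⟨by omega⟩
  have hone : (1 : ZMod p) ≠ 0 := one_ne_zero
  have htwo : (1 : ZMod p) + 1 ≠ 0 := by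
    intro h
    have h2 : ((2 : ℕ) : ZMod p) = 0 := by push_cast; rw [← h]; norm_num
    rw [ZMod.natCast_eq_zero_iff] at h2
    have := Nat.le_of_dvd (by norm_num) h2
    omega
  have hcard : (Finset.univ.filter fun c : Fin n => (c : ℕ) < k).card = k := by
    rw [Fin.card_filter_val_lt]; omega
  have hmem : ∀ c, gM p n k x c ≠ gM p n k (x + Pi.single v 1) c ↔
      (if (c : ℕ) = 0 then (v : ℕ) < k else ((c : ℕ) < k ∨ c = v)) := by
    intro c
    by_cases hc : (c : ℕ) = 0
    · simp only [gM, hc, if_true, Pi.add_apply, Finset.sum_add_distrib]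
      rw [Finset.sum_pi_single']
      by_cases hv : (v : ℕ) < k <;> simp [hv]
    · simp only [gM, hc, if_false, Pi.add_apply, Finset.sum_add_distrib]
      rw [Finset.sum_pi_single']
      by_cases hck : (c : ℕ) < k
      · by_cases hcv : c = v
        · subst hcv
          simp only [hck, Pi.single_eq_same, Finset.mem_univ, if_true, true_or, ne_eq, iff_true]
          intro h
          apply htwo
          linear_combination -h
        · simp only [hck, Finset.mem_univ, if_true, true_or, ne_eq, iff_true,
            Pi.single_eq_of_ne hcv]
          intro h
          apply hone
          linear_combination -h
      · by_cases hcv : c = v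
        · subst hcv
          simp [hck]
        · simp [hck, hcv]
  by_cases hv : (v : ℕ) < k
  · rw [← hcard]
    congr 1
    ext c
    simp only [Finset.mem_filter, Finset.mem_univ, true_and, hmem, hcard]
    by_cases hc : (c : ℕ) = 0
    · simp [hc, hv]; omega
    · simp only [hc, if_false]
      constructor
      · rintro (h | rfl) <;> assumption
      · exact Or.inl
  · have : (Finset.univ.filter fun c => gM p n k x c ≠ gM p n k (x + Pi.single v 1) c) =
        insert v ((Finset.univ.filter fun c : Fin n => (c : ℕ) < k).erase ⟨0, by omega⟩) := by
      ext c
      simp only [Finset.mem_filter, Finset.mem_univ, true_and, hmem, Finset.mem_insert,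
        Finset.mem_erase, Fin.ext_iff, ne_eq]
      split_ifs <;> omega
    rw [this, Finset.card_insert_of_notMem, Finset.card_erase_of_mem, hcard]
    · omega
    · simp; omega
    · simp [hv]

lemma sigma_ofFn {A : Type*} [DecidableEq A] (n : ℕ) (u v : Fin n → A) :
    sigmaRel (Finset.univ.filter fun c => u c ≠ v c).card (List.ofFn u) (List.ofFn v) := by
  refine ⟨by simp, ?_⟩
  have : (List.ofFn u).zip (List.ofFn v) = (List.finRange n).map fun i => (u i, v i) := by
    rw [List.ofFn_eq_map, List.ofFn_eq_map, List.zip_map']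
  rw [this, List.filter_map, List.length_map]
  rfl

lemma cycle_of {A : Type*} [DecidableEq A] (k N : ℕ) (hN : 1 ≤ N) (f : ℕ → List A)
    (hinj : ∀ s t, s < N → t < N → f s = f t → s = t) (hw : f N = f 0)
    (hstep : ∀ t, sigmaRel k (f t) (f (t + 1))) :
    ((Finset.range N).image f).card = N ∧
      ∃ w : ZMod ((Finset.range N).image f).card → List A,
        GrayCycleList k ((Finset.range N).image f) w := by
  have hc : ((Finset.range N).image f).card = N := by
    rw [Finset.card_image_of_injOn, Finset.card_range]
    intro s hs t ht h
    exact hinj s t (by simpa using hs) (by simpa using ht) h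
  refine ⟨hc, ?_⟩
  have hmem : ∀ x, x ∈ (Finset.range N).image f ↔ ∃ t < N, f t = x := by simp
  generalize (Finset.range N).image f = X at hc hmem
  subst hc
  haveI : NeZero X.card := ⟨by omega⟩
  refine ⟨fun i => f i.val, ?_, ?_, ?_⟩
  · intro i j h
    exact ZMod.val_injective _ (hinj _ _ (ZMod.val_lt i) (ZMod.val_lt j) h)
  · intro x
    rw [hmem]
    constructor
    · rintro ⟨t, ht, rfl⟩
      exact ⟨(t : ZMod X.card), by simp only [ZMod.val_natCast, Nat.mod_eq_of_lt ht]⟩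
    · rintro ⟨i, rfl⟩
      exact ⟨i.val, ZMod.val_lt i, rfl⟩
  · intro i
    have h1 : (i + 1).val = (i.val + 1) % X.card := by
      rw [← ZMod.val_natCast]; simp
    have h2 : f (i + 1).val = f (i.val + 1) := by
      rw [h1]
      rcases Nat.lt_or_ge (i.val + 1) X.card with h | h
      · rw [Nat.mod_eq_of_lt h]
      · have h3 : i.val + 1 = X.card := le_antisymm (ZMod.val_lt i) h
        rw [h3, Nat.mod_self, hw]
    show sigmaRel k (f i.val) (f (i + 1).val)
    rw [h2]
    exact hstep _

lemma upper (p n k m : ℕ) (hp : 3 ≤ p) (X : Finset (List (Fin p))) (hX : X.card = m)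
    (hl : ∀ x ∈ X, x.length ≤ n) (w : ZMod X.card → List (Fin p)) (hw : GrayCycleList k X w) :
    m ≤ p ^ n := by
  classical
  obtain ⟨_, hsur, hst⟩ := hw
  have hz : ∀ z : ℕ, (w (z : ZMod X.card)).length = (w 0).length := by
    intro z
    induction z with
    | zero => simp
    | succ z ih => rw [← ih, Nat.cast_succ]; exact (hst _).1.symm
  rcases Nat.eq_zero_or_pos X.card with h0 | h0
  · omega
  haveI : NeZero X.card := ⟨by omega⟩
  have hL : (w 0).length ≤ n := hl _ ((hsur _).2 ⟨0, rfl⟩)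
  have hsub : X ⊆ (Finset.univ : Finset (Fin (w 0).length → Fin p)).image List.ofFn := by
    intro x hx
    obtain ⟨i, rfl⟩ := (hsur x).1 hx
    have h1 := hz i.val
    rw [ZMod.natCast_zmod_val] at h1
    rw [← h1]
    simp only [Finset.mem_image, Finset.mem_univ, true_and]
    exact ⟨(w i).get, List.ofFn_get _⟩
  calc m = X.card := hX.symm
    _ ≤ _ := Finset.card_le_card hsub
    _ ≤ _ := Finset.card_image_le
    _ = p ^ (w 0).length := by simp
    _ ≤ p ^ n := Nat.pow_le_pow_right (by omega) hL

/-- For `p ≥ 3` and `n ≥ k ≥ 1`, the largest cardinality of a set `X` of words of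
length at most `n` over a `p`-letter alphabet admitting a sigma_k-Gray cycle is `p ^ n`. -/
theorem stmt4 (p n k : ℕ) (hp : 3 ≤ p) (hk : 1 ≤ k) (hn : k ≤ n) :
    IsGreatest {m : ℕ | ∃ X : Finset (List (Fin p)), X.card = m ∧
      (∀ x ∈ X, x.length ≤ n) ∧
      ∃ w : ZMod X.card → List (Fin p), GrayCycleList k X w} (p ^ n) := by
  constructor
  · haveI : NeZero p := ⟨by omega⟩
    let e : ZMod p ≃ Fin p := (ZMod.finEquiv p).symm.toEquiv
    let f : ℕ → List (Fin p) := fun t => List.ofFn fun c => e (gM p n k (gx p n t) c)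
    have H := cycle_of k (p ^ n) (Nat.one_le_pow _ _ (by omega)) f ?_ ?_ ?_
    · refine ⟨(Finset.range (p ^ n)).image f, H.1, ?_, H.2⟩
      intro x hx
      obtain ⟨t, _, rfl⟩ := Finset.mem_image.1 hx
      simp [f]
    · intro s t hs ht h
      apply gx_inj p n s t hs ht
      apply gM_inj p n k hk hn
      funext c
      exact e.injective (congrFun (List.ofFn_injective h) c)
    · simp only [f, gx_wrap p n hp]
    · intro t
      obtain ⟨v, hv⟩ := gx_step p n t (by omega) hp
      have h1 := sigma_ofFn n (fun c => e (gM p n k (gx p n t) c))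
        (fun c => e (gM p n k (gx p n (t + 1)) c))
      have h2 := gM_step p n k hp hk hn (gx p n t) v
      simp only [ne_eq, e.injective.eq_iff] at h1
      rw [← hv] at h2
      simp only [ne_eq] at h2
      rw [h2] at h1
      exact h1
  · rintro m ⟨X, hX, hl, w, hw⟩
    exact upper p n k m hp X hX hl w hw
end

section
/- Let k ≥ 1 and let X be a nonempty set of binary words of length exactly k. If there exists a σ_k-Gray cycle over X, then X = {x, θ(x)} for some word x of length k, where θ(x) denotes the bitwise complement of x. Consequently, over the binary alphabet the maximum cardinality of a set X of words of length at most k admitting a σ_k-Gray cycle equals 2. -/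
/-- The bitwise complement of a binary word. -/
def comp2 (x : List (Fin 2)) : List (Fin 2) := x.map fun a => 1 - a

theorem comp2_comp2 (u : List (Fin 2)) : comp2 (comp2 u) = u := by
  simp [comp2]

theorem comp2_ne {u : List (Fin 2)} (h : 1 ≤ u.length) : comp2 u ≠ u := by
  cases u with
  | nil => simp at h
  | cons a t =>
    intro h2
    simp only [comp2, List.map_cons, List.cons.injEq] at h2
    have := h2.1
    revert this
    fin_cases a <;> simp

theorem diff_le (u v : List (Fin 2)) :
    ((u.zip v).filter fun q => decide (q.1 ≠ q.2)).length ≤ u.length := by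
  refine (List.length_filter_le _ _).trans ?_
  simp

theorem diff_eq (u : List (Fin 2)) : ∀ v : List (Fin 2), u.length = v.length →
    ((u.zip v).filter fun q => decide (q.1 ≠ q.2)).length = u.length → v = comp2 u := by
  induction u with
  | nil => intro v h _; exact List.length_eq_zero_iff.1 h.symm
  | cons a t ih =>
    intro v h h2
    cases v with
    | nil => simp at h
    | cons b s =>
      have hl := diff_le t s
      have key : ∀ a b : Fin 2, a ≠ b → b = 1 - a := by decide
      by_cases hab : a = b
      · rw [List.zip_cons_cons, List.filter_cons_of_neg (by simp [hab]), List.length_cons] at h2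
        omega
      · rw [List.zip_cons_cons, List.filter_cons_of_pos (by simp [hab]), List.length_cons,
          List.length_cons] at h2
        have := ih s (by simpa using h) (by omega)
        simp only [comp2, List.map_cons] at this ⊢
        rw [this, key a b hab]

theorem diff_comp (u : List (Fin 2)) : sigmaRel u.length u (comp2 u) := by
  refine ⟨by simp [comp2], ?_⟩
  induction u with
  | nil => simp
  | cons a t ih =>
    have key : ∀ a : Fin 2, a ≠ 1 - a := by decide
    simp only [comp2, List.map_cons, List.zip_cons_cons] at ih ⊢
    rw [List.filter_cons_of_pos (by simpa using key a), List.length_cons, ih, List.length_cons]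

theorem sigma_comp {k : ℕ} {u v : List (Fin 2)} (hu : u.length ≤ k) (h : sigmaRel k u v) :
    u.length = k ∧ v = comp2 u := by
  obtain ⟨h1, h2⟩ := h
  have := diff_le u v
  have hk : u.length = k := by omega
  exact ⟨hk, diff_eq u v h1 (by omega)⟩

theorem gray_pair (k : ℕ) (hk : 1 ≤ k) (X : Finset (List (Fin 2)))
    (hX : ∀ x ∈ X, x.length ≤ k) (w : ZMod X.card → List (Fin 2)) (hw : GrayCycleList k X w) :
    ∃ x : List (Fin 2), x.length = k ∧ X = {x, comp2 x} ∧ X.card = 2 := by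
  obtain ⟨hi, hm, hs⟩ := hw
  have mem : ∀ i, w i ∈ X := fun i => (hm _).2 ⟨i, rfl⟩
  obtain ⟨hl, h1⟩ := sigma_comp (hX _ (mem 0)) (hs 0)
  obtain ⟨-, h2⟩ := sigma_comp (hX _ (mem (0 + 1))) (hs (0 + 1))
  rw [h1, comp2_comp2] at h2
  have h3 : ((2 : ℕ) : ZMod X.card) = 0 := by
    rw [← hi h2]; push_cast; ring
  have h4 : X.card ≤ 2 := Nat.le_of_dvd (by norm_num) ((ZMod.natCast_eq_zero_iff _ _).1 h3)
  have h5 : ({w 0, comp2 (w 0)} : Finset (List (Fin 2))) ⊆ X := by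
    intro x hx
    simp only [Finset.mem_insert, Finset.mem_singleton] at hx
    rcases hx with rfl | rfl
    · exact mem 0
    · rw [← h1]; exact mem _
  have h6 : ({w 0, comp2 (w 0)} : Finset (List (Fin 2))).card = 2 :=
    Finset.card_pair (comp2_ne (by omega)).symm
  have h7 := Finset.eq_of_subset_of_card_le h5 (by omega)
  exact ⟨w 0, hl, h7.symm, (congrArg Finset.card h7).symm.trans h6⟩

theorem gray_exists (x : List (Fin 2)) (hx : 1 ≤ x.length) :
    ∃ X : Finset (List (Fin 2)), X.card = 2 ∧ (∀ y ∈ X, y.length ≤ x.length) ∧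
      ∃ w : ZMod X.card → List (Fin 2), GrayCycleList x.length X w := by
  have hne := comp2_ne hx
  have hc : ({x, comp2 x} : Finset (List (Fin 2))).card = 2 := Finset.card_pair hne.symm
  refine ⟨{x, comp2 x}, hc, ?_, ?_⟩
  · intro y hy
    simp only [Finset.mem_insert, Finset.mem_singleton] at hy
    rcases hy with rfl | rfl <;> simp [comp2]
  · unfold GrayCycleList
    rw [hc]
    have hz : ∀ i : ZMod 2, i = 0 ∨ i = 1 := by decide
    have h11 : (1 : ZMod 2) + 1 = 0 := by decide
    have h10 : (1 : ZMod 2) ≠ 0 := by decide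
    have hd := diff_comp (comp2 x)
    rw [comp2_comp2] at hd
    have hl : (comp2 x).length = x.length := by simp [comp2]
    rw [hl] at hd
    refine ⟨fun i => if i = 0 then x else comp2 x, ?_, ?_, ?_⟩
    · intro i j hij
      rcases hz i with rfl | rfl <;> rcases hz j with rfl | rfl
      · rfl
      · exact absurd (by simpa using hij.symm) hne
      · exact absurd (by simpa using hij) hne
      · rfl
    · intro y
      simp only [Finset.mem_insert, Finset.mem_singleton]
      constructor
      · rintro (rfl | rfl)
        · exact ⟨0, by simp⟩
        · exact ⟨1, by simp⟩
      · rintro ⟨i, rfl⟩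
        rcases hz i with rfl | rfl <;> simp
    · intro i
      rcases hz i with rfl | rfl
      · simpa using diff_comp x
      · simpa [h11] using hd

/-- For `k ≥ 1`: any nonempty set `X` of binary words of length exactly `k`
admitting a sigma_k-Gray cycle equals `{x, comp2 x}` for some word `x` of length `k`;
consequently the largest cardinality of a set of binary words of length at most
`k` admitting a sigma_k-Gray cycle equals `2`. -/
theorem stmt5 (k : ℕ) (hk : 1 ≤ k) :
    (∀ X : Finset (List (Fin 2)), X.Nonempty → (∀ x ∈ X, x.length = k) →
      (∃ w : ZMod X.card → List (Fin 2), GrayCycleList k X w) →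
      ∃ x : List (Fin 2), x.length = k ∧ X = {x, comp2 x}) ∧
    IsGreatest {m : ℕ | ∃ X : Finset (List (Fin 2)), X.card = m ∧
      (∀ x ∈ X, x.length ≤ k) ∧
      ∃ w : ZMod X.card → List (Fin 2), GrayCycleList k X w} 2 := by
  refine ⟨?_, ?_, ?_⟩
  · rintro X - hX ⟨w, hw⟩
    obtain ⟨x, h1, h2, -⟩ := gray_pair k hk X (fun x hx => (hX x hx).le) w hw
    exact ⟨x, h1, h2⟩
  · have := gray_exists (List.replicate k 0) (by simpa using hk)
    simp only [List.length_replicate] at this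
    exact this
  · rintro m ⟨X, rfl, hX, w, hw⟩
    obtain ⟨x, -, -, h⟩ := gray_pair k hk X hX w hw
    exact h.le
end

section
/- For every integer n ≥ 2 there exist two σ_1-Gray cycles γ = (γ_0, …, γ_{2^n-1}) and ρ = (ρ_0, …, ρ_{2^n-1}) over the set of all binary words of length n such that the Hamming distance of ρ_{2^n-1} and γ_0 equals 2, and the Hamming distance of γ_{2^n-1} and ρ_0 equals 2. -/
theorem hd_cons {n : ℕ} (a b : Fin 2) (x y : Fin n → Fin 2) :
    hammingDist (Fin.cons a x : Fin (n+1) → Fin 2) (Fin.cons b y)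
      = (if a = b then 0 else 1) + hammingDist x y := by
  unfold hammingDist
  rw [Finset.card_filter, Finset.card_filter, Fin.sum_univ_succ]
  simp

theorem gray_path (n : ℕ) : ∃ g : ℕ → (Fin n → Fin 2),
    (∀ i j, i < 2 ^ n → j < 2 ^ n → g i = g j → i = j) ∧
    (∀ i, i + 1 < 2 ^ n → hammingDist (g i) (g (i+1)) = 1) ∧
    (1 ≤ n → hammingDist (g (2 ^ n - 1)) (g 0) = 1) := by
  induction n with
  | zero =>
    refine ⟨fun _ => 0, ?_, ?_, ?_⟩ <;> simp
  | succ n ih =>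
    obtain ⟨g, h1, h2, -⟩ := ih
    have hp : 0 < 2 ^ n := by positivity
    have hs : 2 ^ (n+1) = 2 ^ n + 2 ^ n := by ring
    refine ⟨fun i => if i < 2 ^ n then (Fin.cons 0 (g i) : Fin (n+1) → Fin 2)
      else Fin.cons 1 (g (2 ^ (n+1) - 1 - i)), ?_, ?_, ?_⟩
    · intro i j hi hj h
      rw [hs] at hi hj h
      dsimp only at h
      split_ifs at h with a b b
      · exact h1 _ _ a b (Fin.cons_inj.1 h).2
      · have := congrFun h 0; simp at this
      · have := congrFun h 0; simp at this
      · have := h1 _ _ (by omega) (by omega) (Fin.cons_inj.1 h).2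
        omega
    · intro i hi
      rw [hs] at hi ⊢
      dsimp only
      split_ifs with a b b
      · rw [hd_cons, h2 _ b]; simp
      · have : 2 ^ n + 2 ^ n - 1 - (i+1) = i := by omega
        rw [this, hd_cons]; simp
      · omega
      · have := h2 (2 ^ n + 2 ^ n - 1 - (i+1)) (by omega)
        rw [show 2 ^ n + 2 ^ n - 1 - (i+1) + 1 = 2 ^ n + 2 ^ n - 1 - i by omega] at this
        rw [hd_cons, hammingDist_comm, this]; simp
    · intro _
      rw [hs]
      dsimp only
      rw [if_neg (by omega), if_pos hp, Nat.sub_self, hd_cons]; simp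

theorem gray_cycle (n : ℕ) (hn : 1 ≤ n) : ∃ w, GrayCycleAll 2 n 1 w := by
  obtain ⟨g, h1, h2, h3⟩ := gray_path n
  have : NeZero (2 ^ n) := ⟨by positivity⟩
  have : Fact (1 < 2 ^ n) := ⟨Nat.one_lt_two_pow (by omega)⟩
  refine ⟨fun i => g i.val, ?_, ?_⟩
  · rw [Fintype.bijective_iff_injective_and_card]
    refine ⟨fun i j h => ZMod.val_injective _
      (h1 _ _ (ZMod.val_lt i) (ZMod.val_lt j) h), ?_⟩
    simp [ZMod.card]
  · intro i
    have hi := ZMod.val_lt i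
    dsimp only
    rw [ZMod.val_add, ZMod.val_one]
    by_cases h : i.val + 1 < 2 ^ n
    · rw [Nat.mod_eq_of_lt h, h2 _ h]
    · have e : i.val = 2 ^ n - 1 := by omega
      have e2 : i.val + 1 = 2 ^ n := by omega
      rw [e2, Nat.mod_self, e, h3 hn]

theorem fin2_flip : ∀ a b : Fin 2, (a ≠ b + 1 ↔ a = b) := by decide

theorem hd_two {n : ℕ} (x y : Fin n → Fin 2) (i j : Fin n) (hij : i ≠ j)
    (h : ∀ k, x k ≠ y k ↔ k = j) : hammingDist x (y + Pi.single i 1) = 2 := by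
  unfold hammingDist
  refine Eq.trans (congrArg Finset.card ?_) (Finset.card_pair hij)
  ext k
  have hk := h k
  by_cases hki : k = i
  · subst hki
    have : x k = y k := by
      by_contra hc
      exact hij (hk.1 hc)
    simp [this]
  · simp [hki, ← hk]

/-- For every `n ≥ 2` there exist two sigma_1-Gray cycles over all binary
words of length `n` such that the last term of each is at Hamming distance `2`
from the first term of the other. -/
theorem stmt9 (n : ℕ) (hn : 2 ≤ n) :
    ∃ γ ρ : ZMod (2 ^ n) → (Fin n → Fin 2),
      GrayCycleAll 2 n 1 γ ∧ GrayCycleAll 2 n 1 ρ ∧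
      hammingDist (ρ (-1)) (γ 0) = 2 ∧ hammingDist (γ (-1)) (ρ 0) = 2 := by
  obtain ⟨w, hb, hd⟩ := gray_cycle n (by omega)
  have h0 := hd (-1)
  rw [neg_add_cancel] at h0
  obtain ⟨j, hj⟩ := Finset.card_eq_one.1 h0
  have hj' : ∀ k, w (-1) k ≠ w 0 k ↔ k = j := by
    intro k
    have := Finset.ext_iff.1 hj k
    simpa using this
  have : Nontrivial (Fin n) := Fin.nontrivial_iff_two_le.2 hn
  obtain ⟨i, hij⟩ := exists_ne j
  refine ⟨w, fun t => w t + Pi.single i 1, ⟨hb, hd⟩, ⟨?_, ?_⟩, ?_, ?_⟩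
  · exact (Equiv.addRight (Pi.single i 1 : Fin n → Fin 2)).bijective.comp hb
  · intro t
    refine Eq.trans ?_ (hd t)
    simp [hammingDist]
  · rw [hammingDist_comm]
    exact hd_two _ _ i j hij fun k => by rw [ne_comm, hj']
  · exact hd_two _ _ i j hij hj'
end

section
/- Let k ≥ 1 be odd and n ≥ k+1. Suppose γ = (γ_0, …, γ_{2^n-1}) and ρ = (ρ_0, …, ρ_{2^n-1}) are two σ_k-Gray cycles over the set of all binary words of length n such that the Hamming distance of ρ_{2^n-1} and γ_0 equals k+1 and the Hamming distance of γ_{2^n-1} and ρ_0 equals k+1. Then there exist two σ_{k+2}-Gray cycles γ' and ρ' over the set of all binary words of length n+2 such that the Hamming distance of ρ'_{2^{n+2}-1} and γ'_0 equals k+3 and the Hamming distance of γ'_{2^{n+2}-1} and ρ'_0 equals k+3. -/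
def bitOf (m : ℕ) : Fin 2 := ⟨m % 2, Nat.mod_lt _ (by norm_num)⟩

theorem bitOf_eq (a b : ℕ) : bitOf a = bitOf b ↔ a % 2 = b % 2 := by
  simp [bitOf]

theorem hamming_cons {n : ℕ} (a b : Fin 2) (u v : Fin n → Fin 2) :
    hammingDist (Fin.cons a u : Fin (n + 1) → Fin 2) (Fin.cons b v : Fin (n + 1) → Fin 2)
      = (if a = b then 0 else 1) + hammingDist u v := by
  unfold hammingDist
  rw [Fin.card_filter_univ_succ]
  by_cases h : a = b <;> simp [h, add_comm]

/-- The interleaved word at natural index `v`; `c` flips the first bit. -/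
def wordAt {n : ℕ} (γ ρ : ZMod (2 ^ n) → (Fin n → Fin 2)) (c v : ℕ) : Fin (n + 2) → Fin 2 :=
  Fin.cons (bitOf (v / 2 ^ n / 2 + v + c))
    (Fin.cons (bitOf (v / 2 ^ n / 2 + v / 2 ^ n + v))
      (if v / 2 ^ n % 2 = 0 then γ (v : ZMod (2 ^ n)) else ρ (v : ZMod (2 ^ n))) :
        Fin (n + 1) → Fin 2)

theorem wordAt_dist {n : ℕ} (γ ρ : ZMod (2 ^ n) → (Fin n → Fin 2)) (c d v w : ℕ) :
    hammingDist (wordAt γ ρ c v) (wordAt γ ρ d w) =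
      (if (v / 2 ^ n / 2 + v + c) % 2 = (w / 2 ^ n / 2 + w + d) % 2 then 0 else 1) +
      ((if (v / 2 ^ n / 2 + v / 2 ^ n + v) % 2 = (w / 2 ^ n / 2 + w / 2 ^ n + w) % 2
        then 0 else 1) +
      hammingDist (if v / 2 ^ n % 2 = 0 then γ (v : ZMod (2 ^ n)) else ρ (v : ZMod (2 ^ n)))
        (if w / 2 ^ n % 2 = 0 then γ (w : ZMod (2 ^ n)) else ρ (w : ZMod (2 ^ n)))) := by
  unfold wordAt
  rw [hamming_cons, hamming_cons]
  simp only [bitOf_eq]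

theorem wordAt_step {k n : ℕ} (hn : 1 ≤ n) {γ ρ : ZMod (2 ^ n) → (Fin n → Fin 2)}
    (hγ : GrayCycleAll 2 n k γ) (hρ : GrayCycleAll 2 n k ρ)
    (h1 : hammingDist (ρ (-1)) (γ 0) = k + 1)
    (h2 : hammingDist (γ (-1)) (ρ 0) = k + 1) (c v : ℕ) :
    hammingDist (wordAt γ ρ c v) (wordAt γ ρ c (v + 1)) = k + 2 := by
  rw [wordAt_dist]
  have hs := Nat.succ_div (a := v) (b := 2 ^ n)
  by_cases hd : 2 ^ n ∣ v + 1
  · rw [if_pos hd] at hs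
    have e0 : ((v + 1 : ℕ) : ZMod (2 ^ n)) = 0 := (ZMod.natCast_eq_zero_iff _ _).2 hd
    have e1 : ((v : ℕ) : ZMod (2 ^ n)) = -1 := by
      push_cast at e0
      exact eq_neg_of_add_eq_zero_left e0
    rw [hs, e0, e1]
    generalize v / 2 ^ n = q
    rcases Nat.mod_two_eq_zero_or_one q with hq | hq
    · rw [if_pos hq, if_neg (show ¬ (q + 1) % 2 = 0 by omega), h2,
        if_neg (by omega), if_pos (by omega)]
      omega
    · rw [if_neg (show ¬ q % 2 = 0 by omega), if_pos (show (q + 1) % 2 = 0 by omega), h1,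
        if_pos (by omega), if_neg (by omega)]
      omega
  · rw [if_neg hd, add_zero] at hs
    rw [hs]
    generalize v / 2 ^ n = q
    rw [if_neg (by omega), if_neg (by omega)]
    push_cast
    rcases Nat.mod_two_eq_zero_or_one q with hq | hq
    · rw [if_pos hq, if_pos hq, hγ.2]
      omega
    · rw [if_neg (show ¬ q % 2 = 0 by omega), if_neg (show ¬ q % 2 = 0 by omega), hρ.2]
      omega

theorem wordAt_period {n : ℕ} (hn : 1 ≤ n) (γ ρ : ZMod (2 ^ n) → (Fin n → Fin 2)) (c : ℕ) :
    wordAt γ ρ c (2 ^ (n + 2)) = wordAt γ ρ c 0 := by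
  have hp : 0 < 2 ^ n := by positivity
  have e : 2 ^ (n + 2) / 2 ^ n = 4 := by
    rw [pow_add, Nat.mul_div_cancel_left _ hp]; norm_num
  have e2 : ((2 ^ (n + 2) : ℕ) : ZMod (2 ^ n)) = 0 :=
    (ZMod.natCast_eq_zero_iff _ _).2 (pow_dvd_pow 2 (by omega))
  have e3 : 2 ^ (n + 2) = 4 * 2 ^ n := by ring
  rw [← hammingDist_eq_zero, wordAt_dist, e, e2, Nat.zero_div, if_pos (by omega), if_pos (by omega)]
  simp

theorem wordAt_inj {k n : ℕ} {γ ρ : ZMod (2 ^ n) → (Fin n → Fin 2)}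
    (hγ : GrayCycleAll 2 n k γ) (hρ : GrayCycleAll 2 n k ρ) (hn : 1 ≤ n) (c v w : ℕ)
    (hv : v < 2 ^ (n + 2)) (hw : w < 2 ^ (n + 2))
    (h : wordAt γ ρ c v = wordAt γ ρ c w) : v = w := by
  have hp : 0 < 2 ^ n := by positivity
  have h2n : 2 ∣ 2 ^ n := dvd_pow_self 2 (by omega)
  unfold wordAt at h
  rw [Fin.cons_inj, Fin.cons_inj, bitOf_eq, bitOf_eq] at h
  obtain ⟨ha, hb, hc⟩ := h
  have hqv : v / 2 ^ n < 4 := by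
    rw [Nat.div_lt_iff_lt_mul hp]; rw [pow_add] at hv; omega
  have hqw : w / 2 ^ n < 4 := by
    rw [Nat.div_lt_iff_lt_mul hp]; rw [pow_add] at hw; omega
  have hq : v / 2 ^ n % 2 = w / 2 ^ n % 2 := by omega
  have hz : (v : ZMod (2 ^ n)) = (w : ZMod (2 ^ n)) := by
    rw [hq] at hc
    split_ifs at hc with h0
    · exact hγ.1.1 hc
    · exact hρ.1.1 hc
  have hm : v % 2 ^ n = w % 2 ^ n := (ZMod.natCast_eq_natCast_iff' _ _ _).1 hz
  have hm2 : v % 2 = w % 2 := by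
    rw [← Nat.mod_mod_of_dvd v h2n, hm, Nat.mod_mod_of_dvd w h2n]
  have hqq : v / 2 ^ n = w / 2 ^ n := by
    have hh : v / 2 ^ n / 2 % 2 = w / 2 ^ n / 2 % 2 := by
      clear hb hc hz hm hq hqv hqw
      generalize v / 2 ^ n / 2 = a at *
      generalize w / 2 ^ n / 2 = b at *
      omega
    clear ha hb hc hz hm hm2
    generalize v / 2 ^ n = a at *
    generalize w / 2 ^ n = b at *
    omega
  rw [← Nat.div_add_mod v (2 ^ n), ← Nat.div_add_mod w (2 ^ n), hm, hqq]

theorem wordAt_gray {k n : ℕ} (hn : 1 ≤ n) {γ ρ : ZMod (2 ^ n) → (Fin n → Fin 2)}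
    (hγ : GrayCycleAll 2 n k γ) (hρ : GrayCycleAll 2 n k ρ)
    (h1 : hammingDist (ρ (-1)) (γ 0) = k + 1)
    (h2 : hammingDist (γ (-1)) (ρ 0) = k + 1) (c : ℕ) :
    GrayCycleAll 2 (n + 2) (k + 2) (fun i => wordAt γ ρ c i.val) := by
  haveI : NeZero (2 ^ (n + 2)) := ⟨by positivity⟩
  constructor
  · rw [Fintype.bijective_iff_injective_and_card]
    refine ⟨fun i j hij => ?_, by simp [ZMod.card]⟩
    exact ZMod.val_injective _
      (wordAt_inj hγ hρ hn c _ _ (ZMod.val_lt i) (ZMod.val_lt j) hij)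
  · intro i
    have key : wordAt γ ρ c (i + 1).val = wordAt γ ρ c (i.val + 1) := by
      have hlt := ZMod.val_lt i
      have e : (i + 1).val = (i.val + 1) % 2 ^ (n + 2) := by
        rw [← ZMod.val_natCast]; simp
      rw [e]
      rcases Nat.lt_or_ge (i.val + 1) (2 ^ (n + 2)) with hl | hl
      · rw [Nat.mod_eq_of_lt hl]
      · have : i.val + 1 = 2 ^ (n + 2) := by omega
        rw [this, Nat.mod_self, wordAt_period hn]
    change hammingDist (wordAt γ ρ c i.val) (wordAt γ ρ c (i + 1).val) = k + 2
    rw [key]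
    exact wordAt_step hn hγ hρ h1 h2 c _

theorem wordAt_link {k n : ℕ} (hn : 1 ≤ n) {γ ρ : ZMod (2 ^ n) → (Fin n → Fin 2)}
    (h1 : hammingDist (ρ (-1)) (γ 0) = k + 1) (c d : ℕ) (hcd : (c + d) % 2 = 1) :
    hammingDist (wordAt γ ρ c (-1 : ZMod (2 ^ (n + 2))).val)
      (wordAt γ ρ d (0 : ZMod (2 ^ (n + 2))).val) = k + 3 := by
  have hp : 0 < 2 ^ n := by positivity
  have h2n : 2 ∣ 2 ^ n := dvd_pow_self 2 (by omega)
  have ev : (-1 : ZMod (2 ^ (n + 2))).val = 2 ^ (n + 2) - 1 := by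
    obtain ⟨m, hm⟩ : ∃ m, 2 ^ (n + 2) = m + 1 := ⟨2 ^ (n + 2) - 1, by
      have : 0 < 2 ^ (n + 2) := by positivity
      omega⟩
    rw [hm, ZMod.val_neg_one]; rfl
  rw [ev, ZMod.val_zero, wordAt_dist]
  have e3 : 2 ^ (n + 2) = 4 * 2 ^ n := by ring
  have eq : (2 ^ (n + 2) - 1) / 2 ^ n = 3 := by
    rw [Nat.div_eq_iff hp]; omega
  have ez : ((2 ^ (n + 2) - 1 : ℕ) : ZMod (2 ^ n)) = -1 := by
    apply eq_neg_of_add_eq_zero_left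
    have : ((2 ^ (n + 2) - 1 + 1 : ℕ) : ZMod (2 ^ n)) = 0 := by
      rw [ZMod.natCast_eq_zero_iff, Nat.sub_add_cancel (by omega)]
      exact pow_dvd_pow 2 (by omega)
    exact_mod_cast this
  rw [eq, ez, Nat.zero_div, if_neg (by omega), if_neg (by omega), if_neg (by norm_num),
    if_pos (by norm_num), Nat.cast_zero, h1]
  omega

/-- Induction step: from a pair of sigma_k-Gray cycles (`k` odd, `n ≥ k + 1`) over the
binary words of length `n` whose endpoints are cross-linked at Hamming distance
`k + 1`, one obtains a pair of sigma_{k+2}-Gray cycles over the binary words of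
length `n + 2` cross-linked at Hamming distance `k + 3`. -/
theorem stmt10 (k n : ℕ) (hk : Odd k) (hn : k + 1 ≤ n)
    (γ ρ : ZMod (2 ^ n) → (Fin n → Fin 2))
    (hγ : GrayCycleAll 2 n k γ) (hρ : GrayCycleAll 2 n k ρ)
    (h1 : hammingDist (ρ (-1)) (γ 0) = k + 1)
    (h2 : hammingDist (γ (-1)) (ρ 0) = k + 1) :
    ∃ γ' ρ' : ZMod (2 ^ (n + 2)) → (Fin (n + 2) → Fin 2),
      GrayCycleAll 2 (n + 2) (k + 2) γ' ∧ GrayCycleAll 2 (n + 2) (k + 2) ρ' ∧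
      hammingDist (ρ' (-1)) (γ' 0) = k + 3 ∧
      hammingDist (γ' (-1)) (ρ' 0) = k + 3 := by
  have hn1 : 1 ≤ n := by omega
  exact ⟨fun i => wordAt γ ρ 0 i.val, fun i => wordAt γ ρ 1 i.val,
    wordAt_gray hn1 hγ hρ h1 h2 0, wordAt_gray hn1 hγ hρ h1 h2 1,
    wordAt_link hn1 h1 1 0 rfl, wordAt_link hn1 h1 0 1 rfl⟩
end

section
/- For every odd integer k ≥ 1 and every n ≥ k+1, there exist two σ_k-Gray cycles γ = (γ_0, …, γ_{2^n-1}) and ρ = (ρ_0, …, ρ_{2^n-1}) over the set of all binary words of length n such that the Hamming distance of ρ_{2^n-1} and γ_0 equals k+1, and the Hamming distance of γ_{2^n-1} and ρ_0 equals k+1. -/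
theorem hdist_norm_sub {n : ℕ} (x y : Fin n → ZMod 2) :
    hammingDist x y = hammingNorm (x - y) := by
  simp [hammingDist, hammingNorm, sub_eq_zero]

theorem std_gray (n : ℕ) : ∃ f : ℕ → (Fin n → ZMod 2),
    (∀ i j, i < 2 ^ n → j < 2 ^ n → f i = f j → i = j) ∧
    (∀ i, i + 1 < 2 ^ n → ∃ j, f i - f (i + 1) = Pi.single j 1) ∧
    (1 ≤ n → ∃ j, f (2 ^ n - 1) - f 0 = Pi.single j 1) := by
  induction n with
  | zero =>
    refine ⟨fun _ => 0, ?_, ?_, ?_⟩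
    · intro i j hi hj _; simp at hi hj; omega
    · intro i hi; simp at hi
    · intro h; omega
  | succ n ih =>
    obtain ⟨f, hinj, hstep, -⟩ := ih
    have hpow : 2 ^ (n + 1) = 2 * 2 ^ n := by ring
    have hpos : 0 < 2 ^ n := by positivity
    have hneg : (-1 : ZMod 2) = 1 := by decide
    refine ⟨fun i => if i < 2 ^ n then Fin.cons 0 (f i)
      else Fin.cons 1 (f (2 ^ (n + 1) - 1 - i)), ?_, ?_, ?_⟩
    · intro i j hi hj h
      dsimp only at h
      split_ifs at h with h1 h2 h2
      · exact hinj _ _ h1 h2 (Fin.cons_injective2 h).2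
      · exact absurd (Fin.cons_injective2 h).1 (by decide)
      · exact absurd (Fin.cons_injective2 h).1 (by decide)
      · have := hinj _ _ (by omega) (by omega) (Fin.cons_injective2 h).2
        omega
    · intro i hi
      dsimp only
      by_cases h1 : i + 1 < 2 ^ n
      · obtain ⟨j, hj⟩ := hstep i h1
        refine ⟨j.succ, ?_⟩
        rw [if_pos (by omega), if_pos h1]
        ext t
        refine Fin.cases ?_ (fun t => ?_) t
        · simp [Pi.single_apply, (Fin.succ_ne_zero j).symm]
        · have := congrFun hj t
          simpa [Pi.single_apply] using this
      · by_cases h2 : i < 2 ^ n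
        · refine ⟨0, ?_⟩
          rw [if_pos h2, if_neg h1]
          have : 2 ^ (n + 1) - 1 - (i + 1) = i := by omega
          rw [this]
          ext t
          refine Fin.cases ?_ (fun t => ?_) t
          · simp [hneg]
          · simp [Pi.single_apply]
        · obtain ⟨j, hj⟩ := hstep (2 ^ (n + 1) - 1 - (i + 1)) (by omega)
          refine ⟨j.succ, ?_⟩
          rw [if_neg h2, if_neg h1]
          have : 2 ^ (n + 1) - 1 - i = 2 ^ (n + 1) - 1 - (i + 1) + 1 := by omega
          rw [this]
          ext t
          refine Fin.cases ?_ (fun t => ?_) t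
          · simp [Pi.single_apply, (Fin.succ_ne_zero j).symm]
          · have := congrFun hj t
            simp only [Pi.sub_apply] at this
            simp only [Pi.sub_apply, Fin.cons_succ]
            rw [← neg_sub, this]
            by_cases h : t = j <;> simp [Pi.single_apply, h, hneg]
    · intro _
      refine ⟨0, ?_⟩
      dsimp only
      rw [if_pos hpos, if_neg (by omega)]
      have : 2 ^ (n + 1) - 1 - (2 ^ (n + 1) - 1) = 0 := by omega
      rw [this]
      ext t
      refine Fin.cases ?_ (fun t => ?_) t
      · simp
      · simp [Pi.single_apply]

theorem norm_ind {n : ℕ} (T : Finset (Fin n)) :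
    hammingNorm (∑ j ∈ T, (Pi.single j 1 : Fin n → ZMod 2)) = T.card := by
  unfold hammingNorm
  congr 1
  ext i
  simp [Finset.sum_apply, Pi.single_apply]

theorem span_wt (k n : ℕ) (hk : Odd k) (hn : k + 1 ≤ n) :
    ⊤ ≤ Submodule.span (ZMod 2) {v : Fin n → ZMod 2 | hammingNorm v = k} := by
  set S := Submodule.span (ZMod 2) {v : Fin n → ZMod 2 | hammingNorm v = k} with hS
  have hkpos := hk.pos
  have hmem : ∀ T : Finset (Fin n), T.card = k →
      (∑ j ∈ T, (Pi.single j 1 : Fin n → ZMod 2)) ∈ S := fun T hT =>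
    Submodule.subset_span (by simpa [norm_ind] using hT)
  have hdiff : ∀ i j : Fin n,
      (Pi.single i 1 - Pi.single j 1 : Fin n → ZMod 2) ∈ S := by
    intro i j
    by_cases hij : i = j
    · simp [hij]
    have hc : k - 1 ≤ (Finset.univ \ {i, j} : Finset (Fin n)).card := by
      rw [Finset.card_sdiff_of_subset (Finset.subset_univ _), Finset.card_pair hij]
      simp; omega
    obtain ⟨T, hT, hTc⟩ := Finset.exists_subset_card_eq hc
    have hi : i ∉ T := fun h => by simpa using hT h
    have hj : j ∉ T := fun h => by simpa using hT h
    have h1 := hmem (insert i T) (by rw [Finset.card_insert_of_notMem hi]; omega)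
    have h2 := hmem (insert j T) (by rw [Finset.card_insert_of_notMem hj]; omega)
    have := S.sub_mem h1 h2
    rw [Finset.sum_insert hi, Finset.sum_insert hj] at this
    simpa using this
  have hsingle : ∀ i : Fin n, (Pi.single i 1 : Fin n → ZMod 2) ∈ S := by
    intro i
    obtain ⟨T, hT, hTc⟩ := Finset.exists_subset_card_eq
      (s := (Finset.univ : Finset (Fin n))) (n := k) (by simp; omega)
    have h1 := hmem T hTc
    have h2 : (∑ j ∈ T, (Pi.single j 1 - Pi.single i 1 : Fin n → ZMod 2)) ∈ S :=
      S.sum_mem fun j _ => hdiff j i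
    have h3 := S.sub_mem h1 h2
    rw [Finset.sum_sub_distrib, sub_sub_cancel, Finset.sum_const, hTc,
      ← Nat.cast_smul_eq_nsmul (ZMod 2), ZMod.natCast_eq_one_iff_odd.2 hk, one_smul] at h3
    exact h3
  intro v _
  rw [← Finset.univ_sum_single v]
  refine S.sum_mem fun i _ => ?_
  have := S.smul_mem (v i) (hsingle i)
  rwa [← Pi.single_smul, smul_eq_mul, mul_one] at this

theorem norm_add_single {n : ℕ} (d : Fin n → ZMod 2) (j : Fin n) (hj : d j = 0)
    (a : ZMod 2) (ha : a ≠ 0) : hammingNorm (d + Pi.single j a) = hammingNorm d + 1 := by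
  unfold hammingNorm
  rw [← Finset.card_insert_of_notMem (a := j) (s := Finset.univ.filter (fun i => d i ≠ 0))
    (by simp [hj])]
  congr 1
  ext i
  by_cases h : i = j
  · subst h; simp [hj, ha]
  · simp [h]

theorem main_aux (k n : ℕ) (hk : Odd k) (hn : k + 1 ≤ n) :
    ∃ γ ρ : ZMod (2 ^ n) → (Fin n → ZMod 2),
      (Function.Bijective γ ∧ ∀ i, hammingDist (γ i) (γ (i + 1)) = k) ∧
      (Function.Bijective ρ ∧ ∀ i, hammingDist (ρ i) (ρ (i + 1)) = k) ∧
      hammingDist (ρ (-1)) (γ 0) = k + 1 ∧ hammingDist (γ (-1)) (ρ 0) = k + 1 := by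
  have hspan := span_wt k n hk hn
  let b0 := Module.Basis.ofSpan hspan
  have hb0 : ∀ i, hammingNorm (b0 i) = k := fun i =>
    Module.Basis.ofSpan_subset hspan ⟨i, rfl⟩
  haveI := Module.Finite.finite_basis b0
  haveI := Fintype.ofFinite
    ((linearIndepOn_empty (ZMod 2) id).extend (Set.empty_subset
      {v : Fin n → ZMod 2 | hammingNorm v = k}))
  have hcard := Module.finrank_eq_card_basis b0
  rw [Module.finrank_fin_fun] at hcard
  let b := b0.reindex (Fintype.equivFinOfCardEq hcard.symm)
  have hb : ∀ i, hammingNorm (b i) = k := fun i => by simp [b, hb0]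
  let L := b.equivFun.symm
  have hL : ∀ j, L (Pi.single j 1) = b j := fun j => by simp [L]
  obtain ⟨f, hinj, hstep, hlast⟩ := std_gray n
  haveI : NeZero (2 ^ n) := ⟨by positivity⟩
  haveI : Fact (1 < 2 ^ n) := ⟨Nat.one_lt_two_pow (by omega)⟩
  let γ : ZMod (2 ^ n) → (Fin n → ZMod 2) := fun i => L (f i.val)
  have hγinj : Function.Injective γ := fun i j h =>
    ZMod.val_injective _ (hinj _ _ (ZMod.val_lt i) (ZMod.val_lt j) (L.injective h))
  have hγbij : Function.Bijective γ := by
    rw [Fintype.bijective_iff_injective_and_card]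
    exact ⟨hγinj, by simp [ZMod.card]⟩
  have hγstep : ∀ i, hammingNorm (γ i - γ (i + 1)) = k := by
    intro i
    have key : ∃ j, f i.val - f (i + 1).val = Pi.single j 1 := by
      by_cases h : i.val + 1 < 2 ^ n
      · rw [ZMod.val_add_of_lt (by rwa [ZMod.val_one]), ZMod.val_one]
        exact hstep _ h
      · have hlt := ZMod.val_lt i
        have h1 : (i + 1).val = 0 := by
          rw [ZMod.val_add, ZMod.val_one]
          have : i.val + 1 = 2 ^ n := by omega
          rw [this, Nat.mod_self]
        have h2 : i.val = 2 ^ n - 1 := by omega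
        rw [h1, h2]
        exact hlast (by omega)
    obtain ⟨j, hj⟩ := key
    simp only [γ]
    rw [← map_sub, hj, hL, hb]
  have hd := hγstep (-1)
  rw [neg_add_cancel] at hd
  obtain ⟨j, hj⟩ : ∃ j, (γ (-1) - γ 0) j = 0 := by
    by_contra! hcon
    have : hammingNorm (γ (-1) - γ 0) = n := by
      unfold hammingNorm
      rw [Finset.filter_true_of_mem (fun i _ => hcon i)]; simp
    omega
  refine ⟨γ, fun i => γ i + Pi.single j 1, ⟨hγbij, fun i => ?_⟩, ⟨?_, fun i => ?_⟩, ?_, ?_⟩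
  · rw [hdist_norm_sub, hγstep]
  · exact (Equiv.addRight (Pi.single j 1 : Fin n → ZMod 2)).bijective.comp hγbij
  · rw [hdist_norm_sub, add_sub_add_right_eq_sub, hγstep]
  · rw [hdist_norm_sub, add_sub_right_comm, norm_add_single _ _ hj _ (by decide), hd]
  · rw [hdist_norm_sub, ← sub_sub, sub_eq_add_neg, ← Pi.single_neg,
      norm_add_single _ _ hj _ (by decide), hd]

/-- For every odd `k ≥ 1` and `n ≥ k + 1` there exist two sigma_k-Gray cycles over
all binary words of length `n` such that the last term of each is at Hamming
distance `k + 1` from the first term of the other. -/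
theorem stmt11 (k n : ℕ) (hk : Odd k) (hn : k + 1 ≤ n) :
    ∃ γ ρ : ZMod (2 ^ n) → (Fin n → Fin 2),
      GrayCycleAll 2 n k γ ∧ GrayCycleAll 2 n k ρ ∧
      hammingDist (ρ (-1)) (γ 0) = k + 1 ∧ hammingDist (γ (-1)) (ρ 0) = k + 1 := by
  exact main_aux k n hk hn
end

section
/- For every even integer k ≥ 2 and every n ≥ k+1, there exists a σ_k-Gray cycle over Even_1^n, the set of the 2^{n-1} binary words of length n with an even number of occurrences of 1, and there exists a σ_k-Gray cycle over Odd_1^n, the set of the 2^{n-1} binary words of length n with an odd number of occurrences of 1. -/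
/-- A sigma_k-Gray cycle over a finite set `X` of words of length `n` over a `p`-letter
alphabet: a sequence of `X.card` words enumerating each element of `X` exactly once,
with consecutive words (cyclically) at Hamming distance exactly `k`. -/
def GrayCycleOn (p n k : ℕ) (X : Finset (Fin n → Fin p))
    (w : ZMod X.card → (Fin n → Fin p)) : Prop :=
  Function.Injective w ∧ (∀ x, x ∈ X ↔ ∃ i, w i = x) ∧
  ∀ i, hammingDist (w i) (w (i + 1)) = k

/-- The weight of a binary word: the number of positions carrying letter `1`. -/
def wt {n : ℕ} (x : Fin n → Fin 2) : ℕ := (Finset.univ.filter fun i => x i = 1).card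

theorem gray_list {G : Type*} [AddCommGroup G] (h2 : ∀ x : G, x + x = 0) (S : Set G)
    (hS : S.Finite) :
    ∃ L : List G, L.Nodup ∧ (∀ x, x ∈ L ↔ x ∈ AddSubgroup.closure S) ∧
      L.IsChain (fun x y => x + y ∈ S) ∧ L.head? = some 0 ∧
      ((∃ l ∈ S, L.getLast? = some l) ∨ L.length = 1) := by
  induction S, hS using Set.Finite.induction_on with
  | empty => exact ⟨[0], by simp⟩
  | @insert b S hb hS ih =>
    obtain ⟨L, hnd, hmem, hch, hhd, hlast⟩ := ih
    have hch' : L.IsChain (fun x y => x + y ∈ insert b S) :=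
      hch.imp (fun x y h => Set.mem_insert_of_mem _ h)
    have hsub : AddSubgroup.closure S ≤ AddSubgroup.closure (insert b S) :=
      AddSubgroup.closure_mono (Set.subset_insert _ _)
    have hbm : b ∈ AddSubgroup.closure (insert b S) :=
      AddSubgroup.subset_closure (Set.mem_insert _ _)
    by_cases hbc : b ∈ AddSubgroup.closure S
    · refine ⟨L, hnd, ?_, hch', hhd, ?_⟩
      · intro x
        rw [hmem]
        refine ⟨fun h => hsub h, fun h => ?_⟩
        refine (AddSubgroup.closure_le _).2 ?_ h
        exact Set.insert_subset hbc AddSubgroup.subset_closure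
      · rcases hlast with ⟨l, hl, h⟩ | h
        · exact Or.inl ⟨l, Set.mem_insert_of_mem _ hl, h⟩
        · exact Or.inr h
    · have hadd : ∀ x, x + b + b = x := fun x => by rw [add_assoc, h2, add_zero]
      refine ⟨L ++ (L.reverse.map (· + b)), ?_, ?_, ?_, ?_, Or.inl ⟨b, Set.mem_insert _ _, ?_⟩⟩
      · rw [List.nodup_append']
        refine ⟨hnd, (List.nodup_reverse.2 hnd).map (add_left_injective b), ?_⟩
        intro x hx hx'
        simp only [List.mem_map, List.mem_reverse, hmem] at hx hx'
        obtain ⟨y, hy, rfl⟩ := hx'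
        exact hbc ((AddSubgroup.add_mem_cancel_left _ hy).1 hx)
      · intro x
        simp only [List.mem_append, List.mem_map, List.mem_reverse, hmem]
        constructor
        · rintro (h | ⟨y, hy, rfl⟩)
          · exact hsub h
          · exact add_mem (hsub hy) hbm
        · intro h
          induction h using AddSubgroup.closure_induction with
          | mem x hx =>
            rcases hx with rfl | hx
            · exact Or.inr ⟨0, zero_mem _, zero_add _⟩
            · exact Or.inl (AddSubgroup.subset_closure hx)
          | zero => exact Or.inl (zero_mem _)
          | add x y _ _ hx hy =>
            rcases hx with hx | ⟨x, hx, rfl⟩ <;> rcases hy with hy | ⟨y, hy, rfl⟩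
            · exact Or.inl (add_mem hx hy)
            · exact Or.inr ⟨x + y, add_mem hx hy, by abel⟩
            · exact Or.inr ⟨x + y, add_mem hx hy, by abel⟩
            · left
              have : x + b + (y + b) = x + y := by
                rw [add_add_add_comm, h2, add_zero]
              rw [this]; exact add_mem hx hy
          | neg x _ hx =>
            rwa [neg_eq_of_add_eq_zero_left (h2 x)]
      · rw [List.isChain_append]
        refine ⟨hch', ?_, ?_⟩
        · rw [List.isChain_map, List.isChain_reverse]
          refine hch'.imp (fun x y h => ?_)
          have : y + b + (x + b) = x + y := by
            rw [add_add_add_comm, h2, add_zero, add_comm]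
          simpa [flip, this] using h
        · intro x hx y hy
          simp only [List.head?_map, List.head?_reverse] at hy
          rw [Option.mem_def] at hx
          rw [hx] at hy
          simp only [Option.map_some, Option.mem_def, Option.some.injEq] at hy
          subst hy
          rw [← add_assoc, h2, zero_add]
          exact Set.mem_insert _ _
      · simp [List.head?_append, hhd]
      · simp [List.getLast?_append, hhd]

theorem cycle_of_list {G : Type*} (R : G → G → Prop) (L : List G) (N : ℕ) (hN : L.length = N)
    (hnd : L.Nodup) (hch : L.IsChain R) (a b : G) (ha : L.head? = some a)
    (hb : L.getLast? = some b) (hR : R b a) :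
    ∃ w : ZMod N → G, Function.Injective w ∧ (∀ x, x ∈ L ↔ ∃ i, w i = x) ∧
      ∀ i, R (w i) (w (i + 1)) := by
  rcases N with _ | m
  · rw [List.length_eq_zero_iff] at hN
    subst hN
    simp at ha
  · change ∃ w : Fin (m + 1) → G, _
    refine ⟨fun i => L[i.1]'(by omega), ?_, ?_, ?_⟩
    · intro i j h
      exact Fin.ext ((hnd.getElem_inj_iff).1 h)
    · intro x
      rw [List.mem_iff_getElem]
      constructor
      · rintro ⟨i, hi, h⟩
        exact ⟨⟨i, by omega⟩, h⟩
      · rintro ⟨i, h⟩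
        exact ⟨i.1, by omega, h⟩
    · have main : ∀ i j : Fin (m + 1), j = i + 1 →
          R (L[i.1]'(by omega)) (L[j.1]'(by omega)) := by
        intro i j hj
        by_cases hi : i = Fin.last m
        · subst hi
          rw [Fin.last_add_one] at hj
          subst hj
          have h0 : L[0]'(by omega) = a := by
            rw [List.head?_eq_getElem?, List.getElem?_eq_some_iff] at ha
            exact ha.2
          have h1 : L[m]'(by omega) = b := by
            rw [List.getLast?_eq_getElem?, List.getElem?_eq_some_iff] at hb
            obtain ⟨_, hb⟩ := hb
            rw [← hb]; congr 1; omega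
          simp only [Fin.val_last, Fin.val_zero]
          rw [h0, h1]; exact hR
        · have hlt : i < Fin.last m := Fin.lt_last_iff_ne_last.2 hi
          have e : j.1 = i.1 + 1 := by rw [hj]; exact Fin.val_add_one_of_lt hlt
          simp only [e]
          exact List.isChain_iff_getElem.1 hch i.1 (by omega)
      exact fun i => main i _ rfl

theorem fin2_add_self : ∀ x : Fin 2, x + x = 0 := by decide

theorem vec_add_self {n : ℕ} (x : Fin n → Fin 2) : x + x = 0 :=
  funext fun i => fin2_add_self (x i)

theorem wt_eq {n : ℕ} (x : Fin n → Fin 2) : ((wt x : ℕ) : ZMod 2) = (∑ i, x i : Fin 2) := by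
  have : ∀ a : Fin 2, a = if a = 1 then 1 else 0 := by decide
  rw [wt, Finset.card_filter]
  push_cast
  exact Finset.sum_congr rfl fun i _ => (this (x i)).symm

theorem even_wt {n : ℕ} (x : Fin n → Fin 2) : Even (wt x) ↔ ∑ i, x i = 0 := by
  rw [← ZMod.natCast_eq_zero_iff_even, wt_eq]; rfl

theorem odd_wt {n : ℕ} (x : Fin n → Fin 2) : Odd (wt x) ↔ ∑ i, x i = 1 := by
  rw [← ZMod.natCast_eq_one_iff_odd, wt_eq]; rfl

theorem hammingDist_wt {n : ℕ} (x y : Fin n → Fin 2) : hammingDist x y = wt (x + y) := by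
  have : ∀ a b : Fin 2, a ≠ b ↔ a + b = 1 := by decide
  simp only [hammingDist, wt, Pi.add_apply, this]

theorem closure_even (k n : ℕ) (hk : 2 ≤ k) (hke : Even k) (hn : k + 1 ≤ n)
    (x : Fin n → Fin 2) :
    x ∈ AddSubgroup.closure {v : Fin n → Fin 2 | wt v = k} ↔ ∑ i, x i = 0 := by
  constructor
  · intro h
    induction h using AddSubgroup.closure_induction with
    | mem x hx => rw [← even_wt]; rw [Set.mem_ofPred_eq] at hx; rwa [hx]
    | zero => simp
    | add x y _ _ hx hy => simp [Finset.sum_add_distrib, hx, hy]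
    | neg x _ hx => rwa [neg_eq_of_add_eq_zero_left (vec_add_self x)]
  · intro h
    have pair : ∀ i j : Fin n, (Pi.single i 1 + Pi.single j 1 : Fin n → Fin 2) ∈
        AddSubgroup.closure {v : Fin n → Fin 2 | wt v = k} := by
      intro i j
      by_cases hij : i = j
      · subst hij; rw [vec_add_self]; exact zero_mem _
      have hc : k - 1 ≤ (Finset.univ \ {i, j} : Finset (Fin n)).card := by
        rw [Finset.card_sdiff_of_subset (Finset.subset_univ _), Finset.card_pair hij]
        simp; omega
      obtain ⟨A, hA, hAc⟩ := Finset.exists_subset_card_eq hc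
      have key : ∀ B : Finset (Fin n), B.card = k →
          (fun t => if t ∈ B then (1 : Fin 2) else 0) ∈
            AddSubgroup.closure {v : Fin n → Fin 2 | wt v = k} := by
        intro B hB
        apply AddSubgroup.subset_closure
        simp [wt, hB]
      have hiA : i ∉ A := fun h => by simpa using hA h
      have hjA : j ∉ A := fun h => by simpa using hA h
      have h1 := key (insert i A) (by rw [Finset.card_insert_of_notMem hiA]; omega)
      have h2 := key (insert j A) (by rw [Finset.card_insert_of_notMem hjA]; omega)
      have := add_mem h1 h2
      convert this using 1
      funext t
      simp only [Pi.add_apply, Pi.single_apply, Finset.mem_insert]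
      by_cases hti : t = i
      · subst hti; simp [hij, hiA]
      · by_cases htj : t = j
        · subst htj; simp [hti, hjA]
        · by_cases htA : t ∈ A <;> simp [hti, htj, htA]
    have : NeZero n := ⟨by omega⟩
    have hx : x = ∑ i, (if x i = 1 then (Pi.single i 1 + Pi.single 0 1 : Fin n → Fin 2) else 0) := by
      have h01 : ∀ a : Fin 2, (if a = 1 then (1 : Fin 2) else 0) = a := by decide
      have : ∀ i, (if x i = 1 then (Pi.single i 1 + Pi.single 0 1 : Fin n → Fin 2) else 0)
          = Pi.single i (x i) + Pi.single 0 (x i) := by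
        intro i
        have : ∀ a : Fin 2, a = 0 ∨ a = 1 := by decide
        rcases this (x i) with h | h <;> simp [h]
      simp only [this, Finset.sum_add_distrib]
      rw [Finset.univ_sum_single]
      have : ∑ i, (Pi.single 0 (x i) : Fin n → Fin 2) = Pi.single 0 (∑ i, x i) :=
        (map_sum (AddMonoidHom.single (fun _ : Fin n => Fin 2) 0) x Finset.univ).symm
      rw [this, h]; simp
    rw [hx]
    refine sum_mem fun i _ => ?_
    split_ifs
    · exact pair i 0
    · exact zero_mem _

theorem card_even_odd (n : ℕ) (hn : 1 ≤ n) :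
    (Finset.univ.filter fun x : Fin n → Fin 2 => Even (wt x)).card = 2 ^ (n - 1) ∧
    (Finset.univ.filter fun x : Fin n → Fin 2 => Odd (wt x)).card = 2 ^ (n - 1) := by
  have : NeZero n := ⟨by omega⟩
  have hsum := Finset.card_filter_add_card_filter_not (s := (Finset.univ : Finset (Fin n → Fin 2)))
    (fun x => Even (wt x))
  simp only [Nat.not_even_iff_odd] at hsum
  have heq : (Finset.univ.filter fun x : Fin n → Fin 2 => Even (wt x)).card =
      (Finset.univ.filter fun x : Fin n → Fin 2 => Odd (wt x)).card := by
    have hs : ∀ x : Fin n → Fin 2, x + Pi.single 0 1 + Pi.single 0 1 = x := fun x => by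
      rw [add_assoc, vec_add_self, add_zero]
    refine Finset.card_nbij' (· + Pi.single 0 1) (· + Pi.single 0 1) ?_ ?_ ?_ ?_
    · intro x hx
      simp [even_wt, odd_wt, Finset.sum_add_distrib] at hx ⊢
      simp [hx]
    · intro x hx
      simp [even_wt, odd_wt, Finset.sum_add_distrib] at hx ⊢
      simp [hx]
    · intro x _; exact hs x
    · intro x _; exact hs x
  have hu : (Finset.univ : Finset (Fin n → Fin 2)).card = 2 * 2 ^ (n - 1) := by
    rw [← pow_succ', Nat.sub_add_cancel hn]; simp
  omega

theorem gray_coset (k n : ℕ) (hk : 2 ≤ k) (hke : Even k) (hn : k + 1 ≤ n)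
    (X : Finset (Fin n → Fin 2)) (a : Fin n → Fin 2) (hX : ∀ x, x ∈ X ↔ ∑ i, (a + x) i = 0)
    (hc : X.card = 2 ^ (n - 1)) : ∃ w, GrayCycleOn 2 n k X w := by
  obtain ⟨L, hnd, hmem, hch, hhd, hlast⟩ :=
    gray_list vec_add_self {v : Fin n → Fin 2 | wt v = k} (Set.toFinite _)
  have haa : ∀ x, a + (a + x) = x := fun x => by rw [← add_assoc, vec_add_self, zero_add]
  have hmem' : ∀ x, x ∈ X ↔ x ∈ L.map (a + ·) := by
    intro x
    rw [hX, ← closure_even k n hk hke hn, ← hmem, List.mem_map]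
    constructor
    · intro h; exact ⟨_, h, haa x⟩
    · rintro ⟨y, hy, rfl⟩; rwa [haa]
  have hnd' : (L.map (a + ·)).Nodup := hnd.map (add_right_injective a)
  have hlen : (L.map (a + ·)).length = X.card := by
    rw [← List.toFinset_card_of_nodup hnd']
    congr 1; ext x; rw [List.mem_toFinset, hmem']
  have hL1 : L.length ≠ 1 := by
    rw [List.length_map] at hlen
    rw [hlen, hc]
    exact (Nat.one_lt_pow (by omega) (by omega)).ne'
  obtain ⟨l, hl, hlast⟩ := hlast.resolve_right hL1
  have hd : ∀ x y, hammingDist (a + x) (a + y) = wt (x + y) := fun x y => by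
    rw [hammingDist_wt, add_add_add_comm, vec_add_self, zero_add]
  obtain ⟨w, h1, h2, h3⟩ := cycle_of_list (fun x y => hammingDist x y = k) (L.map (a + ·)) X.card
    hlen hnd' (by rw [List.isChain_map]; exact hch.imp fun x y h => (hd x y).trans h)
    (a + 0) (a + l) (by simp [hhd]) (by simp [hlast])
    (by rw [hd, add_zero]; exact hl)
  exact ⟨w, h1, fun x => (hmem' x).trans (h2 x), h3⟩

/-- Proposition 3: for every even `k ≥ 2` and `n ≥ k + 1` there exist sigma_k-Gray
cycles over the `2 ^ (n - 1)` even-weight binary words of length `n` and over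
the `2 ^ (n - 1)` odd-weight ones. -/
theorem stmt14 (k n : ℕ) (hk : 2 ≤ k) (hke : Even k) (hn : k + 1 ≤ n) :
    (Finset.univ.filter fun x : Fin n → Fin 2 => Even (wt x)).card = 2 ^ (n - 1) ∧
    (Finset.univ.filter fun x : Fin n → Fin 2 => Odd (wt x)).card = 2 ^ (n - 1) ∧
    (∃ w : ZMod (Finset.univ.filter fun x : Fin n → Fin 2 => Even (wt x)).card →
        (Fin n → Fin 2),
      GrayCycleOn 2 n k (Finset.univ.filter fun x => Even (wt x)) w) ∧
    (∃ w : ZMod (Finset.univ.filter fun x : Fin n → Fin 2 => Odd (wt x)).card →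
        (Fin n → Fin 2),
      GrayCycleOn 2 n k (Finset.univ.filter fun x => Odd (wt x)) w) := by
  have : NeZero n := ⟨by omega⟩
  obtain ⟨hE, hO⟩ := card_even_odd n (by omega)
  refine ⟨hE, hO, gray_coset k n hk hke hn _ 0 ?_ hE,
    gray_coset k n hk hke hn _ (Pi.single 0 1) ?_ hO⟩
  · intro x
    simp [even_wt]
  · intro x
    have : ∀ a : Fin 2, a = 1 ↔ 1 + a = 0 := by decide
    simp [odd_wt, Finset.sum_add_distrib, this]
end

section
/- Let k ≥ 1 be odd and n ≥ k+1. The maximum cardinality of a finite set X of binary words of length at most n such that some σ_k-Gray cycle over X exists equals 2^n; that is, λ_{A,σ_k}(n) = 2^n for the binary alphabet A and odd k. -/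
namespace GrayAux

lemma gray (m : ℕ) : ∃ w : ℕ → (Fin m → ZMod 2),
    (∀ i j, i < 2 ^ m → j < 2 ^ m → w i = w j → i = j) ∧ w 0 = 0 ∧
    (∀ i, i + 1 < 2 ^ m → ∃ j, w (i + 1) = w i + Pi.single j 1) ∧
    (0 < m → ∃ j, w (2 ^ m - 1) = Pi.single j 1) := by
  induction m with
  | zero =>
    refine ⟨fun _ => 0, ?_, rfl, ?_, ?_⟩
    · intro i j hi hj _
      simp at hi hj
      omega
    · intro i hi
      simp at hi
    · simp
  | succ m ih =>
    obtain ⟨w, hinj, h0, hstep, -⟩ := ih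
    have hp : 2 ^ (m + 1) = 2 * 2 ^ m := by ring
    have hpos : 0 < 2 ^ m := by positivity
    have hc : ∀ (a : ZMod 2) (x : Fin m → ZMod 2) (j : Fin m),
        (Fin.cons a (x + Pi.single j 1) : Fin (m + 1) → ZMod 2)
          = Fin.cons a x + Pi.single j.succ 1 := by
      intro a x j
      funext t
      refine Fin.cases ?_ (fun t => ?_) t
      · simp [Pi.single_apply, (Fin.succ_ne_zero j).symm]
      · simp [Pi.single_apply]
    have hs : ∀ (x : Fin m → ZMod 2), (Fin.cons 1 x : Fin (m + 1) → ZMod 2)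
          = Fin.cons 0 x + Pi.single 0 1 := by
      intro x
      funext t
      refine Fin.cases ?_ (fun t => ?_) t
      · simp
      · simp [Pi.single_apply]
    refine ⟨fun i => if i < 2 ^ m then Fin.cons 0 (w i) else Fin.cons 1 (w (2 * 2 ^ m - 1 - i)),
      ?_, ?_, ?_, ?_⟩
    · intro i j hi hj h
      rw [hp] at hi hj
      dsimp only at h
      split_ifs at h with h1 h2 h2
      · exact hinj _ _ h1 h2 (Fin.cons_inj.1 h).2
      · exact absurd (Fin.cons_inj.1 h).1 (by decide)
      · exact absurd (Fin.cons_inj.1 h).1 (by decide)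
      · have := hinj _ _ (by omega) (by omega) (Fin.cons_inj.1 h).2
        omega
    · simp only [hpos, if_true, h0]
      funext t
      refine Fin.cases ?_ (fun t => ?_) t <;> simp
    · intro i hi
      rw [hp] at hi
      dsimp only
      by_cases h1 : i + 1 < 2 ^ m
      · obtain ⟨j, hj⟩ := hstep i h1
        refine ⟨j.succ, ?_⟩
        rw [if_pos h1, if_pos (by omega), hj, hc]
      · by_cases h2 : i < 2 ^ m
        · refine ⟨0, ?_⟩
          rw [if_neg h1, if_pos h2, hs]
          congr 3
          omega
        · obtain ⟨j, hj⟩ := hstep (2 * 2 ^ m - 1 - (i + 1)) (by omega)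
          refine ⟨j.succ, ?_⟩
          rw [if_neg h1, if_neg h2]
          rw [show 2 * 2 ^ m - 1 - i = 2 * 2 ^ m - 1 - (i + 1) + 1 by omega, hj, hc, add_assoc,
            CharTwo.add_self_eq_zero, add_zero]
    · intro _
      refine ⟨0, ?_⟩
      dsimp only
      rw [hp, if_neg (by omega), Nat.sub_self, h0, hs]
      convert zero_add _
      funext t
      refine Fin.cases ?_ (fun t => ?_) t <;> simp

/-- indicator vector -/
def ind {n : ℕ} (T : Finset (Fin n)) : Fin n → ZMod 2 := ∑ t ∈ T, Pi.single t 1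

lemma ind_norm {n : ℕ} (T : Finset (Fin n)) : hammingNorm (ind T) = T.card := by
  unfold hammingNorm ind
  congr 1
  ext i
  simp [Finset.sum_apply, Pi.single_apply]

lemma span_top (k n : ℕ) (hk : Odd k) (hn : k + 1 ≤ n) :
    Submodule.span (ZMod 2) {v : Fin n → ZMod 2 | hammingNorm v = k} = ⊤ := by
  set S := Submodule.span (ZMod 2) {v : Fin n → ZMod 2 | hammingNorm v = k}
  obtain ⟨r, rfl⟩ := hk
  have hmem : ∀ T : Finset (Fin n), T.card = 2 * r + 1 → ind T ∈ S := fun T hT =>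
    Submodule.subset_span (by simp [ind_norm, hT])
  have hdiff : ∀ i j : Fin n, (Pi.single i 1 - Pi.single j 1 : Fin n → ZMod 2) ∈ S := by
    intro i j
    by_cases hij : i = j
    · simp [hij]
    have : 2 * r ≤ (Finset.univ \ {i, j} : Finset (Fin n)).card := by
      rw [Finset.card_sdiff_of_subset (Finset.subset_univ _), Finset.card_pair hij]
      simp
      omega
    obtain ⟨T, hT, hc⟩ := Finset.exists_subset_card_eq this
    have hi : i ∉ T := fun h => by simpa using hT h
    have hj : j ∉ T := fun h => by simpa using hT h
    have h1 := hmem (insert i T) (by rw [Finset.card_insert_of_notMem hi, hc])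
    have h2 := hmem (insert j T) (by rw [Finset.card_insert_of_notMem hj, hc])
    have := S.sub_mem h1 h2
    unfold ind at this
    rw [Finset.sum_insert hi, Finset.sum_insert hj] at this
    simpa using this
  have hsingle : ∀ i : Fin n, (Pi.single i 1 : Fin n → ZMod 2) ∈ S := by
    intro i
    have : 2 * r ≤ (Finset.univ \ {i} : Finset (Fin n)).card := by
      rw [Finset.card_sdiff_of_subset (Finset.subset_univ _)]
      simp
      omega
    obtain ⟨T, hT, hc⟩ := Finset.exists_subset_card_eq this
    have hi : i ∉ T := fun h => by simpa using hT h
    have h1 := hmem (insert i T) (by rw [Finset.card_insert_of_notMem hi, hc])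
    have h2 : ∑ t ∈ T, (Pi.single t 1 - Pi.single i 1 : Fin n → ZMod 2) ∈ S :=
      S.sum_mem fun t _ => hdiff t i
    have := S.sub_mem h1 h2
    unfold ind at this
    rw [Finset.sum_insert hi, Finset.sum_sub_distrib, Finset.sum_const, hc, mul_comm,
      mul_nsmul', two_nsmul, ← Pi.single_add, CharTwo.add_self_eq_zero] at this
    simpa using this
  rw [eq_top_iff, ← (Pi.basisFun (ZMod 2) (Fin n)).span_eq, Submodule.span_le]
  rintro _ ⟨i, rfl⟩
  simpa using hsingle i

lemma exists_equiv (k n : ℕ) (hk : Odd k) (hn : k + 1 ≤ n) :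
    ∃ T : (Fin n → ZMod 2) ≃ₗ[ZMod 2] (Fin n → ZMod 2),
      ∀ j, hammingNorm (T (Pi.single j 1)) = k := by
  have hs := (span_top k n hk hn).ge
  let b := Module.Basis.ofSpan hs
  let e := b.indexEquiv (Pi.basisFun (ZMod 2) (Fin n))
  refine ⟨(b.reindex e).equivFun.symm, fun j => ?_⟩
  have h : (b.reindex e) j ∈ {v : Fin n → ZMod 2 | hammingNorm v = k} := by
    rw [Module.Basis.reindex_apply]
    exact Module.Basis.ofSpan_subset hs ⟨_, rfl⟩
  have h2 : (b.reindex e).equivFun.symm (Pi.single j 1) = (b.reindex e) j := by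
    simp [Module.Basis.equivFun_symm_apply, Pi.single_apply]
  rw [h2]
  exact h

lemma zip_count {n : ℕ} (u v : Fin n → Fin 2) :
    (((List.ofFn u).zip (List.ofFn v)).filter fun q => decide (q.1 ≠ q.2)).length
      = ∑ i, if u i ≠ v i then 1 else 0 := by
  induction n with
  | zero => simp
  | succ n ih =>
    rw [List.ofFn_succ, List.ofFn_succ, List.zip_cons_cons, List.filter_cons, Fin.sum_univ_succ,
      ← ih]
    by_cases h : u 0 = v 0
    · simp [h]
    · simp [h, add_comm]

lemma sigma_of {k n : ℕ} (u v : Fin n → Fin 2) (h : hammingDist u v = k) :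
    sigmaRel k (List.ofFn u) (List.ofFn v) := by
  refine ⟨by simp, ?_⟩
  rw [zip_count, ← h, hammingDist, Finset.card_filter]

lemma exists_cycle (k n : ℕ) (hk : Odd k) (hn : k + 1 ≤ n) :
    ∃ v : ℕ → (Fin n → Fin 2), (∀ i j, i < 2 ^ n → j < 2 ^ n → v i = v j → i = j) ∧
      (∀ i, i + 1 < 2 ^ n → hammingDist (v i) (v (i + 1)) = k) ∧
      hammingDist (v (2 ^ n - 1)) (v 0) = k := by
  obtain ⟨w, hinj, h0, hstep, hlast⟩ := gray n
  obtain ⟨T, hT⟩ := exists_equiv k n hk hn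
  refine ⟨fun i => T (w i), ?_, ?_, ?_⟩
  · intro i j hi hj h
    exact hinj i j hi hj (T.injective h)
  · intro i hi
    obtain ⟨j, hj⟩ := hstep i hi
    have : hammingDist (T (w i)) (T (w (i + 1))) = k := by
      rw [hammingDist_eq_hammingNorm, ← map_neg, ← map_add, hj, neg_add_cancel_left, hT]
    exact this
  · obtain ⟨j, hj⟩ := hlast (by omega)
    have : hammingDist (T (w (2 ^ n - 1))) (T (w 0)) = k := by
      rw [hammingDist_comm, hammingDist_eq_hammingNorm, ← map_neg, ← map_add, hj, h0, neg_zero, zero_add, hT]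
    exact this

lemma exists_zmod (k n N : ℕ) (hN : N = 2 ^ n) (hk : Odd k) (hn : k + 1 ≤ n) :
    ∃ v : ZMod N → (Fin n → Fin 2), Function.Injective v ∧
      ∀ i, hammingDist (v i) (v (i + 1)) = k := by
  obtain ⟨v, hinj, hstep, hlast⟩ := exists_cycle k n hk hn
  have hpos : 0 < N := by rw [hN]; positivity
  have : NeZero N := ⟨hpos.ne'⟩
  have h1 : 1 < N := by rw [hN]; exact Nat.one_lt_two_pow (by omega)
  have : Fact (1 < N) := ⟨h1⟩
  rw [← hN] at *
  refine ⟨fun i => v i.val, ?_, ?_⟩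
  · intro i j h
    exact ZMod.val_injective N (hinj _ _ (ZMod.val_lt i) (ZMod.val_lt j) h)
  · intro i
    dsimp only
    have hi := ZMod.val_lt i
    rw [ZMod.val_add, ZMod.val_one]
    by_cases h : i.val + 1 < N
    · rw [Nat.mod_eq_of_lt h]
      exact hstep _ h
    · have : i.val = N - 1 := by omega
      rw [this, Nat.sub_add_cancel h1.le, Nat.mod_self]
      exact hlast

end GrayAux

open GrayAux

/-- For the binary alphabet, odd `k ≥ 1` and `n ≥ k + 1`, the largest cardinality
of a set `X` of words of length at most `n` admitting a sigma_k-Gray cycle is `2 ^ n`. -/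
theorem stmt15 (k n : ℕ) (hk : Odd k) (hn : k + 1 ≤ n) :
    IsGreatest {m : ℕ | ∃ X : Finset (List (Fin 2)), X.card = m ∧
      (∀ x ∈ X, x.length ≤ n) ∧
      ∃ w : ZMod X.card → List (Fin 2), GrayCycleList k X w} (2 ^ n) := by
  constructor
  · let X : Finset (List (Fin 2)) := Finset.univ.image (fun f : Fin n → Fin 2 => List.ofFn f)
    have hX : X.card = 2 ^ n := by
      rw [Finset.card_image_of_injective _ List.ofFn_injective]
      simp
    refine ⟨X, hX, ?_, ?_⟩
    · intro x hx
      obtain ⟨f, -, rfl⟩ := Finset.mem_image.1 hx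
      simp
    · obtain ⟨v, hinj, hstep⟩ := exists_zmod k n X.card hX hk hn
      have : NeZero X.card := ⟨by rw [hX]; positivity⟩
      have hbij : Function.Bijective v := by
        rw [Fintype.bijective_iff_injective_and_card]
        refine ⟨hinj, ?_⟩
        rw [ZMod.card, hX]
        simp
      refine ⟨fun i => List.ofFn (v i), List.ofFn_injective.comp hinj, ?_,
        fun i => sigma_of _ _ (hstep i)⟩
      intro x
      constructor
      · intro hx
        obtain ⟨f, -, rfl⟩ := Finset.mem_image.1 hx
        obtain ⟨i, rfl⟩ := hbij.2 f
        exact ⟨i, rfl⟩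
      · rintro ⟨i, rfl⟩
        exact Finset.mem_image.2 ⟨_, Finset.mem_univ _, rfl⟩
  · rintro m ⟨X, rfl, hlen, w, -, hw, hs⟩
    rcases Nat.eq_zero_or_pos X.card with h0 | hpos
    · rw [h0]; positivity
    have : NeZero X.card := ⟨hpos.ne'⟩
    have hl : ∀ j : ℕ, (w (j : ZMod X.card)).length = (w 0).length := by
      intro j
      induction j with
      | zero => simp
      | succ j ih => rw [← ih, Nat.cast_succ]; exact (hs j).1.symm
    have hsub : X ⊆ Finset.univ.image
        (fun f : Fin (w 0).length → Fin 2 => List.ofFn f) := by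
      intro x hx
      obtain ⟨i, rfl⟩ := (hw x).1 hx
      have := hl i.val
      rw [ZMod.natCast_zmod_val] at this
      rw [← this]
      exact Finset.mem_image.2 ⟨_, Finset.mem_univ _, List.ofFn_get _⟩
    calc X.card ≤ _ := Finset.card_le_card hsub
      _ ≤ _ := Finset.card_image_le
      _ = 2 ^ (w 0).length := by simp
      _ ≤ 2 ^ n := Nat.pow_le_pow_right (by norm_num) (hlen _ ((hw _).2 ⟨0, rfl⟩))
end
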